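/- If a permutation w ∈ S_n avoids all of the patterns 53241, 52341, 52431, 35142, 42513, and 351624, then the ideal I_w of S can be generated by n(n−1)/2 − ℓ(w) elements. -/

import Mathlib

/-- One-line notation value of a permutation of `Fin n` at a position `k ∈ {1,…,n}`;
junk value `0` outside that range. -/
def pval {n : ℕ} (w : Equiv.Perm (Fin n)) (k : ℕ) : ℕ :=
  if h : 1 ≤ k ∧ k ≤ n then ((w ⟨k - 1, by omega⟩ : Fin n) : ℕ) + 1 else 0

/-- The rank function `r_w(p,q) = #{k ≤ q : w(k) ≥ p}`. -/
def rk {n : ℕ} (w : Equiv.Perm (Fin n)) (p q : ℕ) : ℕ :=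
  ((Finset.Icc 1 n).filter fun k => k ≤ q ∧ p ≤ pval w k).card

/-- The Rothe diagram `D(w) = {(p,q) ∈ {1,…,n}² : w(q) < p and w⁻¹(p) > q}`. -/
def Diagram {n : ℕ} (w : Equiv.Perm (Fin n)) : Set (ℕ × ℕ) :=
  {pq | 1 ≤ pq.1 ∧ pq.1 ≤ n ∧ 1 ≤ pq.2 ∧ pq.2 ≤ n ∧
    pval w pq.2 < pq.1 ∧ pq.2 < pval w.symm pq.1}

/-- The essential set `E(w)`. -/
def EssSet {n : ℕ} (w : Equiv.Perm (Fin n)) : Set (ℕ × ℕ) :=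
  {pq | pq ∈ Diagram w ∧ (pq.1, pq.2 + 1) ∉ Diagram w ∧ (pq.1 - 1, pq.2) ∉ Diagram w}

/-- Condition A at `(p,q)`: there is no `k` with `k ≤ q` and `w(k) ≥ p`. -/
def CondA {n : ℕ} (w : Equiv.Perm (Fin n)) (p q : ℕ) : Prop :=
  ¬ ∃ k, 1 ≤ k ∧ k ≤ n ∧ k ≤ q ∧ p ≤ pval w k

/-- Condition B at `(p,q)`: there is no `k` with `k > q` and `w(k) < p`. -/
def CondB {n : ℕ} (w : Equiv.Perm (Fin n)) (p q : ℕ) : Prop :=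
  ¬ ∃ k, 1 ≤ k ∧ k ≤ n ∧ q < k ∧ pval w k < p

/-- `w` is defined by inclusions if every essential set box satisfies Condition A or B. -/
def DefinedByInclusions {n : ℕ} (w : Equiv.Perm (Fin n)) : Prop :=
  ∀ p q, (p, q) ∈ EssSet w → CondA w p q ∨ CondB w p q

/-- Index type for the variables `z_{i,j}` with `1 ≤ j < i ≤ n`. -/
abbrev Idx (n : ℕ) : Type := {p : ℕ × ℕ // 1 ≤ p.2 ∧ p.2 < p.1 ∧ p.1 ≤ n}

/-- The polynomial ring `S = ℚ[z_{i,j} : 1 ≤ j < i ≤ n]`. -/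
abbrev PolyS (n : ℕ) : Type := MvPolynomial (Idx n) ℚ

/-- The variable `z_{i,j}` of `S` (junk value `0` when `(i,j)` is out of range). -/
noncomputable def zvar (n : ℕ) (i j : ℕ) : PolyS n :=
  if h : 1 ≤ j ∧ j < i ∧ i ≤ n then MvPolynomial.X ⟨(i, j), h⟩ else 0

/-- The `(i,j)` entry of the matrix `M`: `1` on the diagonal, `z_{i,j}` below the
diagonal, `0` above it (rows and columns indexed by `{1,…,n}`). -/
noncomputable def Mmat (n : ℕ) (i j : ℕ) : PolyS n :=
  if i = j ∧ 1 ≤ i ∧ i ≤ n then 1 else zvar n i j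

/-- The generalized Plücker coordinate `d_{A,B}`: the minor of `M` with rows `A` and
columns `B`, both listed in increasing order (junk value `0` when `#A ≠ #B`). -/
noncomputable def dminor (n : ℕ) (A B : Finset ℕ) : PolyS n :=
  if h : B.card = A.card then
    Matrix.det (Matrix.of fun i j : Fin A.card =>
      Mmat n ((A.orderIsoOfFin rfl i : ℕ)) ((B.orderIsoOfFin h j : ℕ)))
  else 0

/-- The ideal `I_{(p,q,r)}` generated by all `d_{A,B}` with `A ⊆ {p,…,n}`,
`B ⊆ {1,…,q}` and `#A = #B = r+1`. -/
noncomputable def Iideal (n p q r : ℕ) : Ideal (PolyS n) :=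
  Ideal.span {f | ∃ A B : Finset ℕ, A.card = r + 1 ∧ B.card = r + 1 ∧
    A ⊆ Finset.Icc p n ∧ B ⊆ Finset.Icc 1 q ∧ f = dminor n A B}

/-- The ideal `I_w = Σ_{(p,q) ∈ E(w)} I_{(p,q,r_w(p,q))}`. -/
noncomputable def Iw {n : ℕ} (w : Equiv.Perm (Fin n)) : Ideal (PolyS n) :=
  ⨆ pq ∈ EssSet w, Iideal n pq.1 pq.2 (rk w pq.1 pq.2)
/-- `w` contains the (classical) pattern given in one-line notation by the list `v`. -/
def Contains {n : ℕ} (w : Equiv.Perm (Fin n)) (v : List ℕ) : Prop :=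
  ∃ f : Fin v.length → Fin n, StrictMono f ∧
    ∀ j k : Fin v.length, w (f j) < w (f k) ↔ v.get j < v.get k
/-- `ℓ(w)`: the number of inversions of `w`. -/
def ell {n : ℕ} (w : Equiv.Perm (Fin n)) : ℕ :=
  (Finset.univ.filter fun ij : Fin n × Fin n => ij.1 < ij.2 ∧ w ij.2 < w ij.1).card


/-! ### Permutations in one-line notation -/

section OneLine

variable {n : ℕ} (w : Equiv.Perm (Fin n))

theorem pval_mem {k : ℕ} (h1 : 1 ≤ k) (h2 : k ≤ n) : 1 ≤ pval w k ∧ pval w k ≤ n := by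
  unfold pval
  rw [dif_pos ⟨h1, h2⟩]
  have := (w ⟨k - 1, by omega⟩).isLt
  omega

theorem pval_symm_pval {k : ℕ} (h1 : 1 ≤ k) (h2 : k ≤ n) : pval w.symm (pval w k) = k := by
  have h := pval_mem w h1 h2
  unfold pval at h ⊢
  rw [dif_pos ⟨h1, h2⟩] at h
  rw [dif_pos (by rw [dif_pos ⟨h1, h2⟩]; exact h)]
  simp only [dif_pos (And.intro h1 h2), Nat.add_sub_cancel, Fin.eta, Equiv.symm_apply_apply]
  omega

theorem pval_pval_symm {k : ℕ} (h1 : 1 ≤ k) (h2 : k ≤ n) : pval w (pval w.symm k) = k := by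
  simpa using pval_symm_pval w.symm h1 h2

theorem pval_inj {a b : ℕ} (ha : 1 ≤ a) (ha' : a ≤ n) (hb : 1 ≤ b) (hb' : b ≤ n)
    (h : pval w a = pval w b) : a = b := by
  rw [← pval_symm_pval w ha ha', h, pval_symm_pval w hb hb']

theorem pval_out {k : ℕ} (h : n < k) : pval w k = 0 := by
  unfold pval
  rw [dif_neg (by omega)]

theorem exists_position {v : ℕ} (h1 : 1 ≤ v) (h2 : v ≤ n) :
    ∃ k, 1 ≤ k ∧ k ≤ n ∧ pval w k = v ∧ pval w.symm v = k :=
  ⟨pval w.symm v, (pval_mem w.symm h1 h2).1, (pval_mem w.symm h1 h2).2,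
    pval_pval_symm w h1 h2, rfl⟩

/-- The largest value among the first `j` entries. -/
def prefixMax (j : ℕ) : ℕ := (Finset.Icc 1 j).sup (pval w)

variable {w}

theorem pval_le_prefixMax {k j : ℕ} (h1 : 1 ≤ k) (h2 : k ≤ j) : pval w k ≤ prefixMax w j :=
  Finset.le_sup (f := pval w) (Finset.mem_Icc.2 ⟨h1, h2⟩)

theorem prefixMax_le {j x : ℕ} (h : ∀ k, 1 ≤ k → k ≤ j → pval w k ≤ x) : prefixMax w j ≤ x :=
  Finset.sup_le fun k hk => h k (Finset.mem_Icc.1 hk).1 (Finset.mem_Icc.1 hk).2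

theorem prefixMax_le_card (j : ℕ) : prefixMax w j ≤ n := by
  refine prefixMax_le fun k hk _ => ?_
  by_cases h : k ≤ n
  · exact (pval_mem w hk h).2
  · rw [pval_out w (by omega)]; omega

theorem exists_prefixMax {j : ℕ} (h : 1 ≤ j) : ∃ k, 1 ≤ k ∧ k ≤ j ∧ pval w k = prefixMax w j := by
  obtain ⟨k, hk, hk'⟩ := Finset.exists_mem_eq_sup (Finset.Icc 1 j) ⟨1, by simp [h]⟩ (pval w)
  exact ⟨k, (Finset.mem_Icc.1 hk).1, (Finset.mem_Icc.1 hk).2, hk'.symm⟩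

theorem prefixMax_mono {i j : ℕ} (h : i ≤ j) : prefixMax w i ≤ prefixMax w j :=
  prefixMax_le fun _ h1 h2 => pval_le_prefixMax h1 (h2.trans h)

theorem le_prefixMax {j : ℕ} (h : j ≤ n) : j ≤ prefixMax w j := by
  have := Finset.card_le_card_of_injOn (s := Finset.Icc 1 j) (t := Finset.Icc 1 (prefixMax w j))
    (pval w) (fun k hk => by
      simp only [Finset.coe_Icc, Set.mem_Icc] at hk ⊢
      exact ⟨(pval_mem w hk.1 (by omega)).1, pval_le_prefixMax hk.1 hk.2⟩)
    (fun a ha b hb hab => by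
      simp only [Finset.coe_Icc, Set.mem_Icc] at ha hb
      exact pval_inj w ha.1 (by omega) hb.1 (by omega) hab)
  simpa using this

/-- The entry with value `v ≤ j` stands at a position at most `prefixMax w.symm j`. -/
theorem position_le {k j : ℕ} (h1 : 1 ≤ k) (h2 : k ≤ n) (h : pval w k ≤ j) :
    k ≤ prefixMax w.symm j := by
  have := pval_le_prefixMax (w := w.symm) (pval_mem w h1 h2).1 h
  rwa [pval_symm_pval w h1 h2] at this

theorem exists_last_position {j : ℕ} (h : 1 ≤ j) (hj : j ≤ n) :
    1 ≤ prefixMax w.symm j ∧ pval w (prefixMax w.symm j) ≤ j ∧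
      1 ≤ pval w (prefixMax w.symm j) := by
  obtain ⟨k, h1, h2, h3⟩ := exists_prefixMax (w := w.symm) h
  rw [← h3, pval_pval_symm w h1 (by omega)]
  exact ⟨(pval_mem w.symm h1 (by omega)).1, h2, h1⟩

variable (w)

/-- The number of entries whose value satisfies `P`. -/
theorem card_filter_pval (P : ℕ → Prop) [DecidablePred P] :
    ((Finset.Icc 1 n).filter fun k => P (pval w k)).card = ((Finset.Icc 1 n).filter P).card := by
  refine Finset.card_bij' (fun k _ => pval w k) (fun v _ => pval w.symm v) ?_ ?_ ?_ ?_
  · intro k hk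
    simp only [Finset.mem_filter, Finset.mem_Icc] at hk ⊢
    exact ⟨pval_mem w hk.1.1 hk.1.2, hk.2⟩
  · intro k hk
    simp only [Finset.mem_filter, Finset.mem_Icc] at hk ⊢
    rw [pval_pval_symm w hk.1.1 hk.1.2]
    exact ⟨pval_mem w.symm hk.1.1 hk.1.2, hk.2⟩
  · intro k hk
    simp only [Finset.mem_filter, Finset.mem_Icc] at hk
    exact pval_symm_pval w hk.1.1 hk.1.2
  · intro k hk
    simp only [Finset.mem_filter, Finset.mem_Icc] at hk
    exact pval_pval_symm w hk.1.1 hk.1.2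

end OneLine

/-! ### Pattern avoidance in terms of positions -/

/-- Positional form of the avoidance of the six patterns. -/
structure AvoidsSix {n : ℕ} (w : Equiv.Perm (Fin n)) : Prop where
  no53241 : ∀ a b c d e, 1 ≤ a → a < b → b < c → c < d → d < e → e ≤ n →
    pval w e < pval w c → pval w c < pval w b → pval w b < pval w d → pval w d < pval w a → False
  no52341 : ∀ a b c d e, 1 ≤ a → a < b → b < c → c < d → d < e → e ≤ n →
    pval w e < pval w b → pval w b < pval w c → pval w c < pval w d → pval w d < pval w a → False
  no52431 : ∀ a b c d e, 1 ≤ a → a < b → b < c → c < d → d < e → e ≤ n →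
    pval w e < pval w b → pval w b < pval w d → pval w d < pval w c → pval w c < pval w a → False
  no35142 : ∀ a b c d e, 1 ≤ a → a < b → b < c → c < d → d < e → e ≤ n →
    pval w c < pval w e → pval w e < pval w a → pval w a < pval w d → pval w d < pval w b → False
  no42513 : ∀ a b c d e, 1 ≤ a → a < b → b < c → c < d → d < e → e ≤ n →
    pval w d < pval w b → pval w b < pval w e → pval w e < pval w a → pval w a < pval w c → False
  no351624 : ∀ a b c d e f, 1 ≤ a → a < b → b < c → c < d → d < e → e < f → f ≤ n →
    pval w c < pval w e → pval w e < pval w a → pval w a < pval w f → pval w f < pval w b →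
    pval w b < pval w d → False

theorem contains_of_positions {n : ℕ} (w : Equiv.Perm (Fin n)) (v : List ℕ)
    (x : Fin v.length → ℕ) (hx : ∀ i, 1 ≤ x i ∧ x i ≤ n) (h1 : StrictMono x)
    (h : ∀ j k, pval w (x j) < pval w (x k) ↔ v.get j < v.get k) : Contains w v := by
  refine ⟨fun i => ⟨x i - 1, by have := hx i; omega⟩, fun i j hij => ?_, fun j k => ?_⟩
  · have := h1 hij
    have := hx i
    simp only [Fin.mk_lt_mk]
    omega
  · rw [← h]
    unfold pval
    rw [dif_pos (hx j), dif_pos (hx k)]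
    simp

theorem AvoidsSix.of_not_contains {n : ℕ} {w : Equiv.Perm (Fin n)}
    (h1 : ¬ Contains w [5, 3, 2, 4, 1]) (h2 : ¬ Contains w [5, 2, 3, 4, 1])
    (h3 : ¬ Contains w [5, 2, 4, 3, 1]) (h4 : ¬ Contains w [3, 5, 1, 4, 2])
    (h5 : ¬ Contains w [4, 2, 5, 1, 3]) (h6 : ¬ Contains w [3, 5, 1, 6, 2, 4]) :
    AvoidsSix w := by
  refine ⟨fun a b c d e _ _ _ _ _ _ _ _ _ _ =>
      h1 (contains_of_positions w _ (![a, b, c, d, e] : Fin 5 → ℕ) ?_ ?_ ?_),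
    fun a b c d e _ _ _ _ _ _ _ _ _ _ =>
      h2 (contains_of_positions w _ (![a, b, c, d, e] : Fin 5 → ℕ) ?_ ?_ ?_),
    fun a b c d e _ _ _ _ _ _ _ _ _ _ =>
      h3 (contains_of_positions w _ (![a, b, c, d, e] : Fin 5 → ℕ) ?_ ?_ ?_),
    fun a b c d e _ _ _ _ _ _ _ _ _ _ =>
      h4 (contains_of_positions w _ (![a, b, c, d, e] : Fin 5 → ℕ) ?_ ?_ ?_),
    fun a b c d e _ _ _ _ _ _ _ _ _ _ =>
      h5 (contains_of_positions w _ (![a, b, c, d, e] : Fin 5 → ℕ) ?_ ?_ ?_),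
    fun a b c d e f _ _ _ _ _ _ _ _ _ _ _ _ =>
      h6 (contains_of_positions w _ (![a, b, c, d, e, f] : Fin 6 → ℕ) ?_ ?_ ?_)⟩
  case refine_1 | refine_4 | refine_7 | refine_10 | refine_13 | refine_16 =>
    refine Fin.forall_iff.2 fun i hi => ?_
    change i < _ at hi
    simp only [List.length] at hi
    interval_cases i <;> simp <;> omega
  case refine_2 | refine_5 | refine_8 | refine_11 | refine_14 | refine_17 =>
    refine Fin.strictMono_iff_lt_succ.2 fun i => ?_
    fin_cases i <;> simp <;> omega
  all_goals
    intro j k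
    fin_cases j <;> fin_cases k <;> simp <;> omega

/-! ### Counting equations of inclusion type -/

section Counting

variable {n : ℕ} {w : Equiv.Perm (Fin n)}

theorem min_prefixMax_sub_le (hw : AvoidsSix w) {j : ℕ} (h1 : 1 ≤ j) (hj : j ≤ n) :
    min (prefixMax w (prefixMax w.symm j)) (prefixMax w.symm (prefixMax w j)) - prefixMax w j ≤
      ((Finset.Icc 1 n).filter fun b => prefixMax w j < pval w b ∧ b ≤ prefixMax w.symm j).card := by
  set M := prefixMax w j with hM
  set x := prefixMax w.symm j with hx
  have hMn : M ≤ n := prefixMax_le_card j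
  have hxn : x ≤ n := prefixMax_le_card j
  have hjM : j ≤ M := le_prefixMax hj
  have hjx : j ≤ x := le_prefixMax hj
  by_cases hA : ∃ v, M < v ∧ v ≤ prefixMax w x ∧ x < pval w.symm v
  · by_cases hB : ∃ b, x < b ∧ b ≤ prefixMax w.symm M ∧ M < pval w b
    · exfalso
      obtain ⟨v, hv1, hv2, hv3⟩ := hA
      obtain ⟨b, hb1, hb2, hb3⟩ := hB
      obtain ⟨a, ha1, ha2, ha3⟩ := exists_prefixMax (w := w) h1
      obtain ⟨y, hy1, hy2, hy3⟩ := exists_prefixMax (w := w) (j := x) (by omega)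
      obtain ⟨-, hxv, hxv'⟩ := exists_last_position (w := w) h1 hj
      obtain ⟨-, hu, hu'⟩ := exists_last_position (w := w) (j := M) (by omega) hMn
      have hgn : prefixMax w.symm M ≤ n := prefixMax_le_card M
      set s := prefixMax w.symm M with hs
      have hUn : prefixMax w x ≤ n := prefixMax_le_card x
      obtain ⟨k, hk1, hk2, hk3, hk4⟩ := exists_position w (v := v) (by omega) (by omega)
      rw [← hx] at hxv hxv'
      have hjy : j < y := by
        by_contra hc
        have := pval_le_prefixMax (w := w) hy1 (not_lt.1 hc)
        omega
      have hyx : y ≠ x := by rintro rfl; omega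
      have hbs : b ≠ s := by rintro rfl; omega
      have hsj : j < pval w s := by
        by_contra hc
        have := position_le (w := w) (k := s) (j := j) (by omega) hgn (by omega)
        omega
      have hsM : pval w s ≠ M := fun hc => by
        have := pval_inj w (a := s) (b := a) (by omega) hgn ha1 (by omega) (by omega)
        omega
      have hkn : v ≠ prefixMax w x := fun hc => by
        have := pval_inj w (a := k) (b := y) hk1 hk2 hy1 (by omega) (by omega)
        omega
      have hby : pval w b ≠ pval w y := fun hc => by
        have := pval_inj w (a := b) (b := y) (by omega) (by omega) hy1 (by omega) hc
        omega
      have hks : k ≠ s := by rintro rfl; omega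
      rcases lt_or_gt_of_ne hby with hlt | hgt
      · exact hw.no35142 a y x b s ha1 (by omega) (by omega) (by omega) (by omega) hgn
          (by omega) (by omega) (by omega) (by omega)
      · rcases lt_or_gt_of_ne hks with hlt' | hgt'
        · exact hw.no35142 a y x k s ha1 (by omega) (by omega) (by omega) (by omega) hgn
            (by omega) (by omega) (by omega) (by omega)
        · exact hw.no351624 a y x b s k ha1 (by omega) (by omega) (by omega) (by omega)
            (by omega) hk2 (by omega) (by omega) (by omega) (by omega) (by omega)
    · push Not at hB
      refine le_trans (Nat.sub_le_sub_right (min_le_right _ _) _) ?_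
      have hgn : prefixMax w.symm M ≤ n := prefixMax_le_card M
      set s := prefixMax w.symm M with hs
      have h := Finset.card_filter_add_card_filter_not (s := Finset.Icc 1 s) (fun b => M < pval w b)
      have h2 : ((Finset.Icc 1 s).filter fun b => ¬ M < pval w b).card ≤ (Finset.Icc 1 M).card := by
        refine Finset.card_le_card_of_injOn (pval w) ?_ ?_
        · intro b hb
          simp only [Finset.coe_filter, Finset.mem_Icc, Set.mem_ofPred_eq, Finset.coe_Icc,
            Set.mem_Icc] at hb ⊢
          have := pval_mem w hb.1.1 (by omega)
          omega
        · intro a ha b hb hab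
          simp only [Finset.coe_filter, Finset.mem_Icc, Set.mem_ofPred_eq] at ha hb
          exact pval_inj w ha.1.1 (by omega) hb.1.1 (by omega) hab
      have h3 : ((Finset.Icc 1 s).filter fun b => M < pval w b).card ≤
          ((Finset.Icc 1 n).filter fun b => M < pval w b ∧ b ≤ x).card := by
        refine Finset.card_le_card fun b hb => ?_
        simp only [Finset.mem_filter, Finset.mem_Icc] at hb ⊢
        refine ⟨⟨hb.1.1, by omega⟩, hb.2, ?_⟩
        by_contra hc
        have := hB b (by omega) hb.1.2
        omega
      simp only [Nat.card_Icc] at h h2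
      omega
  · push Not at hA
    refine le_trans (Nat.sub_le_sub_right (min_le_left _ _) _) ?_
    have hUn : prefixMax w x ≤ n := prefixMax_le_card x
    rw [← Nat.card_Ioc]
    refine Finset.card_le_card_of_injOn (pval w.symm) ?_ ?_
    · intro v hv
      simp only [Finset.coe_Ioc, Set.mem_Ioc, Finset.coe_filter, Finset.mem_Icc,
        Set.mem_ofPred_eq] at hv ⊢
      have h1 := pval_mem w.symm (k := v) (by omega) (by omega)
      have h2 := pval_pval_symm w (k := v) (by omega) (by omega)
      have h3 := hA v hv.1 hv.2
      omega
    · intro a ha b hb hab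
      simp only [Finset.coe_Ioc, Set.mem_Ioc] at ha hb
      exact pval_inj w.symm (by omega) (by omega) (by omega) (by omega) hab

theorem card_filter_position_le (b : ℕ) :
    ((Finset.Icc 1 n).filter fun a => prefixMax w a < pval w b ∧ b ≤ prefixMax w.symm a).card ≤
      ((Finset.Icc 1 n).filter fun a => prefixMax w a < pval w b ∧
        b ≤ prefixMax w.symm (pval w a)).card := by
  set A := (Finset.Icc 1 n).filter fun a => prefixMax w a < pval w b with hA
  have e1 := Finset.card_filter_add_card_filter_not (s := A) (fun a => b ≤ prefixMax w.symm a)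
  have e2 := Finset.card_filter_add_card_filter_not (s := A)
    (fun a => b ≤ prefixMax w.symm (pval w a))
  rw [← Finset.filter_filter, ← Finset.filter_filter, ← hA]
  suffices h : (A.filter fun a => ¬ b ≤ prefixMax w.symm (pval w a)).card ≤
      (A.filter fun a => ¬ b ≤ prefixMax w.symm a).card by omega
  by_cases hc : ∀ a ∈ A, ¬ b ≤ prefixMax w.symm a
  · rw [Finset.filter_true_of_mem hc]
    exact Finset.card_filter_le _ _
  · push Not at hc
    obtain ⟨a₀, ha₀, hba⟩ := hc
    refine Finset.card_le_card_of_injOn (pval w) ?_ ?_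
    · intro a ha
      simp only [hA, Finset.coe_filter, Finset.mem_filter, Finset.mem_Icc,
        Set.mem_ofPred_eq] at ha ha₀ ⊢
      have h1 := pval_mem w ha.1.1.1 ha.1.1.2
      refine ⟨⟨h1, lt_of_le_of_lt (prefixMax_mono ?_) ha₀.2⟩, ha.2⟩
      by_contra hlt
      have := prefixMax_mono (w := w.symm) (not_le.1 hlt).le
      omega
    · intro a ha a' ha' haa
      simp only [hA, Finset.coe_filter, Finset.mem_filter, Finset.mem_Icc,
        Set.mem_ofPred_eq] at ha ha'
      exact pval_inj w ha.1.1.1 ha.1.1.2 ha'.1.1.1 ha'.1.1.2 haa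

variable (w) in
/-- Indices `(i,j)` of the entries of the inverse matrix which are forced to vanish. -/
def inverseEqs : Finset (ℕ × ℕ) :=
  (Finset.Icc 1 n ×ˢ Finset.Icc 1 n).filter fun x => prefixMax w.symm x.2 < x.1

variable (w) in
/-- Indices `(i,j)` of the entries of the matrix whose vanishing has to be imposed in addition to
the vanishing of the entries of the inverse matrix indexed by `inverseEqs`. -/
def entryEqs : Finset (ℕ × ℕ) :=
  (Finset.Icc 1 n ×ˢ Finset.Icc 1 n).filter fun x => prefixMax w x.2 < x.1 ∧
    x.1 ≤ prefixMax w (prefixMax w.symm x.2) ∧ x.1 ≤ prefixMax w.symm (prefixMax w x.2)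

theorem card_inverseEqs : (inverseEqs w).card =
    ((Finset.Icc 1 n ×ˢ Finset.Icc 1 n).filter fun x =>
      prefixMax w.symm (pval w x.1) < x.2).card := by
  refine Finset.card_bij' (fun x _ => (pval w.symm x.2, x.1)) (fun x _ => (x.2, pval w x.1))
    ?_ ?_ ?_ ?_
  · rintro ⟨i, j⟩ h
    simp only [inverseEqs, Finset.mem_filter, Finset.mem_product, Finset.mem_Icc] at h ⊢
    rw [pval_pval_symm w h.1.2.1 h.1.2.2]
    exact ⟨⟨pval_mem w.symm h.1.2.1 h.1.2.2, h.1.1⟩, h.2⟩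
  · rintro ⟨i, j⟩ h
    simp only [inverseEqs, Finset.mem_filter, Finset.mem_product, Finset.mem_Icc] at h ⊢
    exact ⟨⟨h.1.2, pval_mem w h.1.1.1 h.1.1.2⟩, h.2⟩
  · rintro ⟨i, j⟩ h
    simp only [inverseEqs, Finset.mem_filter, Finset.mem_product, Finset.mem_Icc] at h
    simp [pval_pval_symm w h.1.2.1 h.1.2.2]
  · rintro ⟨i, j⟩ h
    simp only [Finset.mem_filter, Finset.mem_product, Finset.mem_Icc] at h
    simp [pval_symm_pval w h.1.1.1 h.1.1.2]

theorem card_filter_product_eq_sum (s : Finset ℕ) (P : ℕ → ℕ → Prop) [∀ a b, Decidable (P a b)] :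
    ((s ×ˢ s).filter fun x => P x.1 x.2).card = ∑ a ∈ s, (s.filter fun b => P a b).card := by
  simp only [Finset.card_filter, Finset.sum_product]

theorem card_entryEqs_le (hw : AvoidsSix w) : (entryEqs w).card ≤
    ((Finset.Icc 1 n ×ˢ Finset.Icc 1 n).filter fun x =>
      prefixMax w x.1 < pval w x.2 ∧ x.2 ≤ prefixMax w.symm (pval w x.1)).card := by
  have e1 : (entryEqs w).card = ∑ j ∈ Finset.Icc 1 n, ((Finset.Icc 1 n).filter fun i =>
      prefixMax w j < i ∧ i ≤ prefixMax w (prefixMax w.symm j) ∧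
        i ≤ prefixMax w.symm (prefixMax w j)).card := by
    simp only [entryEqs, Finset.card_filter, Finset.sum_product]
    exact Finset.sum_comm
  rw [e1, card_filter_product_eq_sum (Finset.Icc 1 n) fun a b =>
    prefixMax w a < pval w b ∧ b ≤ prefixMax w.symm (pval w a)]
  calc _ ≤ ∑ j ∈ Finset.Icc 1 n, ((Finset.Icc 1 n).filter fun b =>
        prefixMax w j < pval w b ∧ b ≤ prefixMax w.symm j).card := by
        refine Finset.sum_le_sum fun j hj => le_trans ?_
          (min_prefixMax_sub_le hw (Finset.mem_Icc.1 hj).1 (Finset.mem_Icc.1 hj).2)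
        rw [← Nat.card_Ioc]
        refine Finset.card_le_card fun i hi => ?_
        simp only [Finset.mem_filter, Finset.mem_Icc, Finset.mem_Ioc] at hi ⊢
        omega
    _ = ∑ b ∈ Finset.Icc 1 n, ((Finset.Icc 1 n).filter fun a =>
        prefixMax w a < pval w b ∧ b ≤ prefixMax w.symm a).card := by
        simp only [Finset.card_filter]
        exact Finset.sum_comm
    _ ≤ ∑ b ∈ Finset.Icc 1 n, ((Finset.Icc 1 n).filter fun a =>
        prefixMax w a < pval w b ∧ b ≤ prefixMax w.symm (pval w a)).card :=
        Finset.sum_le_sum fun b _ => card_filter_position_le b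
    _ = _ := by
        simp only [Finset.card_filter]
        exact Finset.sum_comm

end Counting

/-! ### Essential boxes which are not given by inclusions -/

section Determinantal

variable {n : ℕ} {w : Equiv.Perm (Fin n)}

variable (w) in
/-- An essential box at which neither Condition A nor Condition B holds. -/
def IsDeterminantal (p q : ℕ) : Prop :=
  (p, q) ∈ EssSet w ∧ ¬ CondA w p q ∧ ¬ CondB w p q

/-- The values next to a determinantal box. -/
theorem IsDeterminantal.facts {p q : ℕ} (h : IsDeterminantal w p q) :
    2 ≤ p ∧ p ≤ n ∧ 1 ≤ q ∧ q + 1 ≤ n ∧ pval w q < p ∧ p ≤ pval w (q + 1) ∧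
      (∃ c, 1 ≤ c ∧ c ≤ q ∧ pval w c = p - 1) ∧ (∃ d, q < d ∧ d ≤ n ∧ pval w d = p) := by
  obtain ⟨⟨⟨hp1, hpn, hq1, hqn, hwq, hqp⟩, hr, hu⟩, -, hB⟩ := h
  simp only [CondB, not_not] at hB
  obtain ⟨k, hk1, hkn, hqk, -⟩ := hB
  simp only at hp1 hpn hq1 hqn hwq hqp hr hu
  have m1 := pval_mem w hq1 hqn
  have hd := pval_mem w.symm hp1 hpn
  have hd' := pval_pval_symm w hp1 hpn
  have hc := pval_mem w.symm (k := p - 1) (by omega) (by omega)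
  have hc' := pval_pval_symm w (k := p - 1) (by omega) (by omega)
  refine ⟨by omega, hpn, hq1, by omega, hwq, ?_, ⟨_, hc.1, ?_, hc'⟩, ⟨_, hqp, hd.2, hd'⟩⟩
  · by_contra hlt
    refine hr ⟨hp1, hpn, by simp, by simp only; omega, not_le.1 hlt, ?_⟩
    simp only
    have : pval w.symm p ≠ q + 1 := fun e => by rw [e] at hd'; omega
    omega
  · by_contra hlt
    refine hu ⟨by simp only; omega, by simp only; omega, hq1, hqn, ?_, not_le.1 hlt⟩
    simp only
    have : pval w q ≠ p - 1 := fun e => by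
      rw [← e, pval_symm_pval w hq1 hqn] at hlt
      omega
    omega

theorem IsDeterminantal.exists_low (hw : AvoidsSix w) {p q : ℕ} (h : IsDeterminantal w p q)
    {a b : ℕ} (ha : 1 ≤ a) (haq : a ≤ q) (hpa : p ≤ pval w a) (hqb : q < b) (hb : b ≤ n)
    (hbp : pval w b < p) :
    ∃ e, a < e ∧ e ≤ q ∧ pval w b < pval w e ∧ pval w e < p := by
  obtain ⟨hp, hpn, hq, hqn, hwq, hwq', ⟨c, hc1, hc2, hc3⟩, ⟨d, hd1, hd2, hd3⟩⟩ := h.facts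
  have i1 := pval_inj w (a := b) (b := c) (by omega) (by omega) hc1 (by omega)
  rcases lt_or_ge a c with hac | hac
  · exact ⟨c, hac, hc2, by omega, by omega⟩
  have haq' : a ≠ q := by rintro rfl; omega
  have hac' : a ≠ c := by rintro rfl; omega
  rcases lt_or_ge (pval w b) (pval w q) with hbq | hbq
  · exact ⟨q, by omega, le_rfl, hbq, hwq⟩
  exfalso
  have i2 := pval_inj w (a := b) (b := q) (by omega) (by omega) hq (by omega)
  have i3 := pval_inj w (a := a) (b := d) (by omega) (by omega) (by omega) hd2
  have i4 := pval_inj w (a := a) (b := q + 1) (by omega) (by omega) (by omega) hqn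
  have i5 := pval_inj w (a := d) (b := q + 1) (by omega) (by omega) (by omega) hqn
  have hbd : b ≠ d := by rintro rfl; omega
  have hbq : b ≠ q + 1 := by rintro rfl; omega
  have hdq := pval_inj w (a := q + 1) (b := d) (by omega) hqn (by omega) hd2
  rcases lt_or_gt_of_ne hbd with hlt | hgt
  · rcases lt_or_ge (pval w (q + 1)) (pval w a) with h1 | h1
    · exact hw.no35142 c a q (q + 1) b hc1 (by omega) (by omega) (by omega) (by omega) hb
        (by omega) (by omega) (by omega) (by omega)
    · exact hw.no351624 c a q (q + 1) b d hc1 (by omega) (by omega) (by omega) (by omega)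
        (by omega) hd2 (by omega) (by omega) (by omega) (by omega) (by omega)
  · exact hw.no35142 c a q d b hc1 (by omega) (by omega) (by omega) (by omega) hb
        (by omega) (by omega) (by omega) (by omega)

theorem IsDeterminantal.exists_high (hw : AvoidsSix w) {p q : ℕ} (h : IsDeterminantal w p q)
    {a b : ℕ} (ha : 1 ≤ a) (haq : a ≤ q) (hpa : p ≤ pval w a) (hqb : q < b) (hb : b ≤ n)
    (hbp : pval w b < p) :
    ∃ t, q < t ∧ t < b ∧ p ≤ pval w t ∧ pval w t < pval w a := by
  obtain ⟨e, he1, he2, he3, he4⟩ := h.exists_low hw ha haq hpa hqb hb hbp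
  obtain ⟨hp, hpn, hq, hqn, hwq, hwq', -, ⟨d, hd1, hd2, hd3⟩⟩ := h.facts
  have i3 := pval_inj w (a := a) (b := d) (by omega) (by omega) (by omega) hd2
  have i4 := pval_inj w (a := a) (b := q + 1) (by omega) (by omega) (by omega) hqn
  have hbd : b ≠ d := by rintro rfl; omega
  have hbq : b ≠ q + 1 := by rintro rfl; omega
  rcases lt_or_gt_of_ne hbd with hlt | hgt
  · rcases lt_or_ge (pval w (q + 1)) (pval w a) with h1 | h1
    · exact ⟨q + 1, by omega, by omega, hwq', h1⟩
    · exfalso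
      exact hw.no42513 a e (q + 1) b d ha (by omega) (by omega) (by omega) (by omega) hd2
        (by omega) (by omega) (by omega) (by omega)
  · exact ⟨d, hd1, hgt, by omega, by omega⟩

/-- Every determinantal box lies between the middle entries of an occurrence of `4231`. -/
theorem IsDeterminantal.exists_middle (hw : AvoidsSix w) {p q : ℕ} (h : IsDeterminantal w p q) :
    ∃ a e t b, 1 ≤ a ∧ a < e ∧ e ≤ q ∧ q < t ∧ t < b ∧ b ≤ n ∧ pval w b < pval w e ∧
      pval w e < p ∧ p ≤ pval w t ∧ pval w t < pval w a := by
  have hA := h.2.1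
  have hB := h.2.2
  simp only [CondA, CondB, not_not] at hA hB
  obtain ⟨a, ha1, han, haq, hpa⟩ := hA
  obtain ⟨b, hb1, hbn, hqb, hbp⟩ := hB
  obtain ⟨e, he1, he2, he3, he4⟩ := h.exists_low hw ha1 haq hpa hqb hbn hbp
  obtain ⟨t, ht1, ht2, ht3, ht4⟩ := h.exists_high hw ha1 haq hpa hqb hbn hbp
  exact ⟨a, e, t, b, ha1, he1, he2, ht1, ht2, hbn, he3, he4, ht3, ht4⟩

theorem IsDeterminantal.not_lt_of_middle (hw : AvoidsSix w) {p q p' q' a e t b : ℕ}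
    (h : IsDeterminantal w p q) (h' : IsDeterminantal w p' q') (ha : 1 ≤ a) (hae : a < e)
    (heq : e ≤ q) (hqt' : q' < t) (htb : t < b) (hb : b ≤ n) (hbe : pval w b < pval w e)
    (hep : pval w e < p) (hpt' : p' ≤ pval w t) (het : pval w e < pval w t)
    (hta : pval w t < pval w a) : ¬ q < q' := by
  intro hlt
  obtain ⟨hp, hpn, hq, hqn, hwq, hwq', -, -⟩ := h.facts
  obtain ⟨hp', hpn', hq', hqn', hwq2, hwq2', -, -⟩ := h'.facts
  have i1 := pval_inj w (a := q + 1) (b := t) (by omega) (by omega) (by omega) (by omega)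
  have i2 := pval_inj w (a := q + 1) (b := a) (by omega) (by omega) (by omega) (by omega)
  have i3 := pval_inj w (a := q') (b := e) (by omega) (by omega) (by omega) (by omega)
  have i4 := pval_inj w (a := q') (b := b) (by omega) (by omega) (by omega) (by omega)
  have hbig : pval w a < pval w (q + 1) := by
    by_contra hc
    rcases lt_or_ge (pval w (q + 1)) (pval w t) with h1 | h1
    · exact hw.no52341 a e (q + 1) t b ha hae (by omega) (by omega) htb hb hbe (by omega) h1 hta
    · exact hw.no52431 a e (q + 1) t b ha hae (by omega) (by omega) htb hb hbe (by omega)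
        (by omega) (by omega)
  have hsmall : pval w q' < pval w b := by
    by_contra hc
    rcases lt_or_ge (pval w q') (pval w e) with h1 | h1
    · exact hw.no53241 a e q' t b ha hae (by omega) (by omega) htb hb (by omega) h1 (by omega) hta
    · exact hw.no52341 a e q' t b ha hae (by omega) (by omega) htb hb hbe (by omega) (by omega) hta
  have hne : q' ≠ q + 1 := by rintro rfl; omega
  exact hw.no35142 e (q + 1) q' t b (by omega) (by omega) (by omega) (by omega) htb hb hsmall hbe
    (by omega) (by omega)

theorem IsDeterminantal.not_lt_of_middle' (hw : AvoidsSix w) {p q p' q' a e t b : ℕ}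
    (h : IsDeterminantal w p q) (h' : IsDeterminantal w p' q') (ha : 1 ≤ a) (hae : a < e)
    (heq : e ≤ q) (hqt' : q' < t) (htb : t < b) (hb : b ≤ n) (hbe : pval w b < pval w e)
    (hep : pval w e < p) (hpt' : p' ≤ pval w t) (het : e < t)
    (hta : pval w t < pval w a) : ¬ p < p' := by
  intro hlt
  obtain ⟨hp, hpn, hq, hqn, hwq, hwq', -, ⟨d, hd1, hd2, hd3⟩⟩ := h.facts
  obtain ⟨hp', hpn', hq', hqn', hwq2, hwq2', ⟨c, hc1, hc2, hc3⟩, -⟩ := h'.facts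
  have n1 : d ≠ t := by rintro rfl; omega
  have n2 : d ≠ b := by rintro rfl; omega
  have n3 : c ≠ e := by rintro rfl; omega
  have n4 : c ≠ a := by rintro rfl; omega
  have hd : b < d := by
    by_contra hc
    rcases lt_or_ge d t with h1 | h1
    · exact hw.no52341 a e d t b ha hae (by omega) h1 htb hb hbe (by omega) (by omega) hta
    · exact hw.no52431 a e t d b ha hae (by omega) (by omega) (by omega) hb hbe (by omega)
        (by omega) hta
  have hc : c < a := by
    by_contra hc
    rcases lt_or_ge c e with h1 | h1
    · exact hw.no53241 a c e t b ha (by omega) h1 (by omega) htb hb hbe (by omega) (by omega) hta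
    · exact hw.no52341 a e c t b ha hae (by omega) (by omega) htb hb hbe (by omega) (by omega) hta
  have n5 : p ≠ p' - 1 := fun hh => by
    have := pval_inj w (a := c) (b := d) hc1 (by omega) (by omega) hd2 (by omega)
    omega
  exact hw.no42513 c e t b d hc1 (by omega) (by omega) htb hd hd2 hbe (by omega) (by omega)
    (by omega)

theorem IsDeterminantal.eq_of_middle (hw : AvoidsSix w) {p q p' q' a e t b a' b' : ℕ}
    (h : IsDeterminantal w p q) (h' : IsDeterminantal w p' q')
    (hm : 1 ≤ a ∧ a < e ∧ e ≤ q ∧ q < t ∧ t < b ∧ b ≤ n ∧ pval w b < pval w e ∧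
      pval w e < p ∧ p ≤ pval w t ∧ pval w t < pval w a)
    (hm' : 1 ≤ a' ∧ a' < e ∧ e ≤ q' ∧ q' < t ∧ t < b' ∧ b' ≤ n ∧ pval w b' < pval w e ∧
      pval w e < p' ∧ p' ≤ pval w t ∧ pval w t < pval w a') : p = p' ∧ q = q' := by
  obtain ⟨m1, m2, m3, m4, m5, m6, m7, m8, m9, m10⟩ := hm
  obtain ⟨m1', m2', m3', m4', m5', m6', m7', m8', m9', m10'⟩ := hm'
  have e1 := h.not_lt_of_middle hw h' m1 m2 m3 m4' m5 m6 m7 m8 m9' (by omega) m10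
  have e2 := h'.not_lt_of_middle hw h m1 m2 m3' m4 m5 m6 m7 m8' m9 (by omega) m10
  have e3 := h.not_lt_of_middle' hw h' m1 m2 m3 m4' m5 m6 m7 m8 m9' (by omega) m10
  have e4 := h'.not_lt_of_middle' hw h m1 m2 m3' m4 m5 m6 m7 m8' m9 (by omega) m10
  omega

open Classical in
variable (w) in
/-- The determinantal boxes of `w`. -/
noncomputable def determinantalBoxes : Finset (ℕ × ℕ) :=
  (Finset.Icc 1 n ×ˢ Finset.Icc 1 n).filter fun x => IsDeterminantal w x.1 x.2

theorem mem_determinantalBoxes {p q : ℕ} :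
    (p, q) ∈ determinantalBoxes w ↔ IsDeterminantal w p q := by
  simp only [determinantalBoxes, Finset.mem_filter, Finset.mem_product, Finset.mem_Icc,
    and_iff_right_iff_imp]
  intro h
  obtain ⟨hp, hpn, hq, hqn, -⟩ := h.facts
  omega

theorem card_determinantalBoxes_le (hw : AvoidsSix w) : (determinantalBoxes w).card ≤
    ((Finset.Icc 1 n ×ˢ Finset.Icc 1 n).filter fun x => x.1 < x.2 ∧ pval w x.1 < pval w x.2 ∧
      pval w x.2 ≤ prefixMax w x.1 ∧ x.2 ≤ prefixMax w.symm (pval w x.1)).card := by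
  have H : ∀ x : ℕ × ℕ, ∃ y : ℕ × ℕ, x ∈ determinantalBoxes w → ∃ a b, 1 ≤ a ∧ a < y.1 ∧
      y.1 ≤ x.2 ∧ x.2 < y.2 ∧ y.2 < b ∧ b ≤ n ∧ pval w b < pval w y.1 ∧
      pval w y.1 < x.1 ∧ x.1 ≤ pval w y.2 ∧ pval w y.2 < pval w a := by
    intro x
    by_cases hx : x ∈ determinantalBoxes w
    · obtain ⟨a, e, t, b, h⟩ := (mem_determinantalBoxes.1 hx).exists_middle hw
      exact ⟨(e, t), fun _ => ⟨a, b, h⟩⟩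
    · exact ⟨x, fun h => absurd h hx⟩
  choose f hf using H
  refine Finset.card_le_card_of_injOn f ?_ ?_
  · intro x hx
    obtain ⟨a, b, h1, h2, h3, h4, h5, h6, h7, h8, h9, h10⟩ := hf x hx
    simp only [Finset.coe_filter, Finset.mem_product, Finset.mem_Icc, Set.mem_ofPred_eq]
    have := pval_le_prefixMax (w := w) h1 h2.le
    have := position_le (w := w) (k := b) (j := pval w (f x).1) (by omega) h6 h7.le
    omega
  · intro x hx y hy hxy
    obtain ⟨a, b, h⟩ := hf x hx
    obtain ⟨a', b', h'⟩ := hf y hy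
    rw [← hxy] at h'
    obtain ⟨h1, h2⟩ := (mem_determinantalBoxes.1 hx).eq_of_middle hw
      (mem_determinantalBoxes.1 hy) h h'
    exact Prod.ext h1 h2

/-- There are at most as many equations as noninversions. -/
theorem card_equations_le (hw : AvoidsSix w) :
    (inverseEqs w).card + (entryEqs w).card + (determinantalBoxes w).card ≤
      ((Finset.Icc 1 n ×ˢ Finset.Icc 1 n).filter fun x =>
        x.1 < x.2 ∧ pval w x.1 < pval w x.2).card := by
  have h1 := card_inverseEqs (w := w)
  have h2 := card_entryEqs_le hw
  have h3 := card_determinantalBoxes_le hw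
  refine (Nat.add_le_add (Nat.add_le_add h1.le h2) h3).trans ?_
  rw [← Finset.card_union_of_disjoint, ← Finset.card_union_of_disjoint]
  · refine Finset.card_le_card fun x hx => ?_
    simp only [Finset.mem_union, Finset.mem_filter, Finset.mem_product, Finset.mem_Icc] at hx ⊢
    have hr : ((1 ≤ x.1 ∧ x.1 ≤ n) ∧ 1 ≤ x.2 ∧ x.2 ≤ n) := by tauto
    refine ⟨hr, ?_⟩
    rcases hx with (⟨-, hx⟩ | ⟨-, hx⟩) | ⟨-, hx⟩
    · have a1 := position_le (w := w) hr.1.1 hr.1.2 le_rfl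
      have a2 := position_le (w := w) (j := pval w x.1) hr.2.1 hr.2.2
      omega
    · have a1 := pval_le_prefixMax (w := w) hr.1.1 le_rfl
      have a2 := pval_le_prefixMax (w := w) (j := x.1) hr.2.1
      omega
    · exact ⟨hx.1, hx.2.1⟩
  · rw [Finset.disjoint_left]
    intro x hx hx'
    simp only [Finset.mem_union, Finset.mem_filter] at hx hx'
    omega
  · rw [Finset.disjoint_left]
    intro x hx hx'
    simp only [Finset.mem_filter] at hx hx'
    omega

theorem card_noninversions : ((Finset.Icc 1 n ×ˢ Finset.Icc 1 n).filter fun x =>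
    x.1 < x.2 ∧ pval w x.1 < pval w x.2).card = n * (n - 1) / 2 - ell w := by
  have e1 : ((Finset.Icc 1 n ×ˢ Finset.Icc 1 n).filter fun x =>
      x.1 < x.2 ∧ pval w x.1 < pval w x.2).card =
      (Finset.univ.filter fun x : Fin n × Fin n => x.1 < x.2 ∧ w x.1 < w x.2).card := by
    symm
    refine Finset.card_bij (fun x _ => (x.1.val + 1, x.2.val + 1)) ?_ ?_ ?_
    · intro x hx
      simp only [Finset.mem_filter, Finset.mem_univ, true_and, Finset.mem_product,
        Finset.mem_Icc] at hx ⊢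
      have := x.1.isLt
      have := x.2.isLt
      unfold pval
      rw [dif_pos (by omega), dif_pos (by omega)]
      simp only [Nat.add_sub_cancel, Fin.eta]
      omega
    · intro x _ y _ h
      simp only [Prod.mk.injEq, Nat.add_right_cancel_iff] at h
      exact Prod.ext (Fin.ext h.1) (Fin.ext h.2)
    · rintro ⟨i, j⟩ hx
      simp only [Finset.mem_filter, Finset.mem_product, Finset.mem_Icc] at hx
      unfold pval at hx
      rw [dif_pos (by omega), dif_pos (by omega)] at hx
      refine ⟨(⟨i - 1, by omega⟩, ⟨j - 1, by omega⟩), ?_, ?_⟩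
      · simp only [Finset.mem_filter, Finset.mem_univ, true_and, Fin.lt_def]
        omega
      · simp only [Prod.mk.injEq]
        omega
  have e2 : (Finset.univ.filter fun x : Fin n × Fin n => x.1 < x.2).card = n * (n - 1) / 2 := by
    rw [← Finset.sum_range_id, ← Fin.sum_univ_eq_sum_range (fun i => i), Finset.card_filter,
      ← Finset.univ_product_univ, Finset.sum_product_right]
    refine Finset.sum_congr rfl fun j _ => ?_
    rw [← Finset.card_filter, ← Fin.card_Iio j]
    congr 1
    ext i
    simp
  have e3 := Finset.card_filter_add_card_filter_not
    (s := Finset.univ.filter fun x : Fin n × Fin n => x.1 < x.2) (fun x => w x.1 < w x.2)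
  rw [Finset.filter_filter, Finset.filter_filter] at e3
  have e4 : (Finset.univ.filter fun x : Fin n × Fin n => x.1 < x.2 ∧ ¬ w x.1 < w x.2).card =
      ell w := by
    unfold ell
    congr 1
    ext x
    simp only [Finset.mem_filter, Finset.mem_univ, true_and]
    refine and_congr_right fun h => ?_
    have : w x.1 ≠ w x.2 := fun e => h.ne (w.injective e)
    omega
  omega

end Determinantal

/-! ### Rows and columns outside the corner minor of a determinantal box -/

section Corner

variable {n : ℕ} {w : Equiv.Perm (Fin n)}

theorem card_filter_gt (x : ℕ) : ((Finset.Icc 1 n).filter fun k => x < k).card = n - x := by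
  have : ((Finset.Icc 1 n).filter fun k => x < k) = Finset.Ioc x n := by
    ext k
    simp only [Finset.mem_filter, Finset.mem_Icc, Finset.mem_Ioc]
    omega
  rw [this, Nat.card_Ioc]

theorem card_filter_lt {x : ℕ} (h : x ≤ n + 1) :
    ((Finset.Icc 1 n).filter fun k => k < x).card = x - 1 := by
  have : ((Finset.Icc 1 n).filter fun k => k < x) = Finset.Ico 1 x := by
    ext k
    simp only [Finset.mem_filter, Finset.mem_Icc, Finset.mem_Ico]
    omega
  rw [this, Nat.card_Ico]

theorem card_high_add_rk (p q : ℕ) (hp : 1 ≤ p) :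
    ((Finset.Icc 1 n).filter fun k => q < k ∧ p ≤ pval w k).card + rk w p q = n + 1 - p := by
  have h := card_filter_pval w (fun v => p - 1 < v)
  rw [card_filter_gt] at h
  have h2 := Finset.card_filter_add_card_filter_not
    (s := (Finset.Icc 1 n).filter fun k => p - 1 < pval w k) (fun k => q < k)
  rw [Finset.filter_filter, Finset.filter_filter, h] at h2
  rw [show n + 1 - p = n - (p - 1) by omega, ← h2]
  unfold rk
  congr 2 <;>
  · ext k
    simp only [Finset.mem_filter, Finset.mem_Icc]
    omega

theorem card_low_add_rk {p q : ℕ} (hq : q ≤ n) :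
    ((Finset.Icc 1 n).filter fun k => k ≤ q ∧ pval w k < p).card + rk w p q = q := by
  have h := card_filter_lt (n := n) (x := q + 1) (by omega)
  have h2 := Finset.card_filter_add_card_filter_not
    (s := (Finset.Icc 1 n).filter fun k => k < q + 1) (fun k => pval w k < p)
  rw [Finset.filter_filter, Finset.filter_filter, h] at h2
  rw [Nat.add_sub_cancel] at h2
  conv_rhs => rw [← h2]
  unfold rk
  congr 2 <;>
  · ext k
    simp only [Finset.mem_filter, Finset.mem_Icc]
    omega

theorem card_le_max_add_one {s x z : Finset ℕ} (h : x ⊆ z ∨ z ⊆ x)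
    (h1 : (s \ (x ∪ z)).card ≤ 1) : s.card ≤ max x.card z.card + 1 := by
  have := Finset.card_le_card_sdiff_add_card (s := s) (t := x ∪ z)
  have : (x ∪ z).card = max x.card z.card := by
    rcases h with h | h
    · rw [Finset.union_eq_right.2 h, max_eq_right (Finset.card_le_card h)]
    · rw [Finset.union_eq_left.2 h, max_eq_left (Finset.card_le_card h)]
  omega

theorem subset_or_subset {x z : Finset ℕ} (h : ∀ a ∈ x, ∀ b ∈ z, a ∉ z → b ∉ x → False) :
    x ⊆ z ∨ z ⊆ x := by
  by_contra! hc
  obtain ⟨a, ha, ha'⟩ := Finset.not_subset.1 hc.1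
  obtain ⟨b, hb, hb'⟩ := Finset.not_subset.1 hc.2
  exact h a ha b hb ha' hb'

theorem card_le_one_of_not_lt {s : Finset ℕ} (h : ∀ a ∈ s, ∀ b ∈ s, a < b → False) :
    s.card ≤ 1 := by
  refine Finset.card_le_one.2 fun a ha b hb => ?_
  rcases lt_trichotomy a b with h1 | h1 | h1
  · exact (h a ha b hb h1).elim
  · exact h1
  · exact (h b hb a ha h1).elim

theorem IsDeterminantal.rows (hw : AvoidsSix w) {p q : ℕ} (h : IsDeterminantal w p q) :
    prefixMax w q ≤ p + rk w p q ∨ prefixMax w.symm (p - 1) ≤ p + rk w p q := by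
  by_contra! hc
  obtain ⟨hc1, hc2⟩ := hc
  obtain ⟨hp, hpn, hq, hqn, hwq, hwq', -, -⟩ := h.facts
  have hA := h.2.1
  have hB := h.2.2
  simp only [CondA, CondB, not_not] at hA hB
  obtain ⟨a', ha1, han, haq', hpa⟩ := hA
  obtain ⟨b', hb1, hbn, hqb, hbp⟩ := hB
  obtain ⟨a, ha, haq, haP⟩ := exists_prefixMax (w := w) hq
  have hpP := hpa.trans (pval_le_prefixMax (w := w) ha1 haq')
  obtain ⟨hb, hbv, hbv'⟩ := exists_last_position (w := w) (j := p - 1) (by omega) (by omega)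
  have hbQ := position_le (w := w) (j := p - 1) hb1 hbn (by omega)
  have hbn' : prefixMax w.symm (p - 1) ≤ n := prefixMax_le_card _
  set b := prefixMax w.symm (p - 1) with hbdef
  have hPn : prefixMax w q ≤ n := prefixMax_le_card _
  have key := card_high_add_rk (w := w) p q (by omega)
  have hX := card_filter_pval w (fun v => prefixMax w q < v)
  rw [card_filter_gt] at hX
  have hZ := card_filter_gt (n := n) b
  obtain ⟨e, he1, he2, he3, he4⟩ := h.exists_low hw ha haq (by omega) (b := b) (by omega)
    hbn' (by omega)
  have htop : ∀ x, 1 ≤ x → x ≤ n → prefixMax w q < pval w x → q < x := fun x h1 _ h3 => by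
    by_contra hc
    have := pval_le_prefixMax (w := w) h1 (not_lt.1 hc)
    omega
  have hlate : ∀ x, 1 ≤ x → x ≤ n → b < x → p ≤ pval w x := fun x h1 h2 h3 => by
    by_contra hc
    have := position_le (w := w) (j := p - 1) h1 h2 (by omega)
    omega
  have := card_le_max_add_one
    (s := (Finset.Icc 1 n).filter fun k => q < k ∧ p ≤ pval w k)
    (x := (Finset.Icc 1 n).filter fun k => prefixMax w q < pval w k)
    (z := (Finset.Icc 1 n).filter fun k => b < k) ?_ ?_
  · omega
  · refine subset_or_subset fun x hx z hz hx' hz' => ?_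
    simp only [Finset.mem_filter, Finset.mem_Icc] at hx hz hx' hz'
    have h1 := htop x hx.1.1 hx.1.2 hx.2
    have h2 := hlate z hz.1.1 hz.1.2 hz.2
    have i1 : x ≠ b := by rintro rfl; omega
    have i2 := pval_inj w (a := a) (b := z) (by omega) (by omega) (by omega) (by omega)
    exact hw.no42513 a e x b z ha (by omega) (by omega) (by omega) (by omega) (by omega)
      (by omega) (by omega) (by omega) (by omega)
  · refine card_le_one_of_not_lt fun y hy y' hy' hlt => ?_
    simp only [Finset.mem_sdiff, Finset.mem_union, Finset.mem_filter, Finset.mem_Icc] at hy hy'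
    have i0 : y' ≠ b := by rintro rfl; omega
    have i1 := pval_inj w (a := a) (b := y) (by omega) (by omega) (by omega) (by omega)
    have i2 := pval_inj w (a := a) (b := y') (by omega) (by omega) (by omega) (by omega)
    have i3 := pval_inj w (a := y) (b := y') (by omega) (by omega) (by omega) (by omega)
    rcases lt_or_ge (pval w y) (pval w y') with h1 | h1
    · exact hw.no52341 a e y y' b ha (by omega) (by omega) (by omega) (by omega) (by omega)
        (by omega) (by omega) (by omega) (by omega)
    · exact hw.no52431 a e y y' b ha (by omega) (by omega) (by omega) (by omega) (by omega)
        (by omega) (by omega) (by omega) (by omega)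

theorem IsDeterminantal.columns (hw : AvoidsSix w) {p q : ℕ} (h : IsDeterminantal w p q) :
    prefixMax w (q - rk w p q - 1) < p ∨ prefixMax w.symm (q - rk w p q - 1) ≤ q := by
  by_contra! hc
  obtain ⟨hc1, hc2⟩ := hc
  obtain ⟨hp, hpn, hq, hqn, hwq, hwq', -, -⟩ := h.facts
  have key := card_low_add_rk (w := w) (p := p) (q := q) (by omega)
  set j := q - rk w p q - 1 with hj
  have hj0 : 1 ≤ j := by
    by_contra hc
    have : prefixMax w j ≤ 0 := prefixMax_le fun k h1 h2 => by omega
    omega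
  have hex : ∃ a, 1 ≤ a ∧ a ≤ j ∧ p ≤ pval w a := by
    obtain ⟨k, h1, h2, h3⟩ := exists_prefixMax (w := w) hj0
    exact ⟨k, h1, h2, by omega⟩
  have hex' : ∃ v, 1 ≤ v ∧ v ≤ j ∧ q < pval w.symm v := by
    obtain ⟨k, h1, h2, h3⟩ := exists_prefixMax (w := w.symm) hj0
    exact ⟨k, h1, h2, by omega⟩
  obtain ⟨a, ⟨ha, haj, hpa⟩, hmin⟩ : ∃ a, (1 ≤ a ∧ a ≤ j ∧ p ≤ pval w a) ∧
      ∀ k, k < a → ¬ (1 ≤ k ∧ k ≤ j ∧ p ≤ pval w k) :=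
    ⟨Nat.find hex, Nat.find_spec hex, fun k => Nat.find_min hex⟩
  obtain ⟨v, ⟨hv, hvj, hqv⟩, hvmin⟩ : ∃ v, (1 ≤ v ∧ v ≤ j ∧ q < pval w.symm v) ∧
      ∀ k, k < v → ¬ (1 ≤ k ∧ k ≤ j ∧ q < pval w.symm k) :=
    ⟨Nat.find hex', Nat.find_spec hex', fun k => Nat.find_min hex'⟩
  obtain ⟨b, hb1, hbn, hbv, hbv'⟩ := exists_position w (v := v) hv (by omega)
  rw [hbv'] at hqv
  have hB := h.2.2
  simp only [CondB, not_not] at hB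
  obtain ⟨b', hb1', hbn', hqb', hbp'⟩ := hB
  have hsmall : ∀ x, 1 ≤ x → x ≤ n → pval w x < v → x ≤ q := fun x h1 h2 h3 => by
    have h5 := pval_mem w h1 h2
    have h4 := hvmin (pval w x) h3
    rw [pval_symm_pval w h1 h2] at h4
    omega
  have hvp : v < p := by
    have := pval_inj w (a := b) (b := b') (by omega) (by omega) (by omega) (by omega)
    by_contra hc
    have := hsmall b' hb1' hbn'
    omega
  have hearly : ∀ x, 1 ≤ x → x < a → pval w x < p := fun x h1 h2 => by
    have := hmin x h2
    omega
  obtain ⟨t, ht1, ht2, ht3, ht4⟩ := h.exists_high hw ha (by omega) hpa hqv hbn (by omega)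
  have hZ := card_filter_pval w (fun u => u < v)
  rw [card_filter_lt (by omega)] at hZ
  have hX := card_filter_lt (n := n) (x := a) (by omega)
  have := card_le_max_add_one
    (s := (Finset.Icc 1 n).filter fun k => k ≤ q ∧ pval w k < p)
    (x := (Finset.Icc 1 n).filter fun k => k < a)
    (z := (Finset.Icc 1 n).filter fun k => pval w k < v) ?_ ?_
  · omega
  · refine subset_or_subset fun x hx z hz hx' hz' => ?_
    simp only [Finset.mem_filter, Finset.mem_Icc] at hx hz hx' hz'
    have h1 := hearly x hx.1.1 hx.2
    have h2 := hsmall z hz.1.1 hz.1.2 hz.2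
    have i1 : z ≠ a := by rintro rfl; omega
    have i2 := pval_inj w (a := x) (b := b) (by omega) (by omega) (by omega) (by omega)
    exact hw.no35142 x a z t b hx.1.1 (by omega) (by omega) (by omega) (by omega) (by omega)
      (by omega) (by omega) (by omega) (by omega)
  · refine card_le_one_of_not_lt fun y hy y' hy' hlt => ?_
    simp only [Finset.mem_sdiff, Finset.mem_union, Finset.mem_filter, Finset.mem_Icc] at hy hy'
    have i0 : y ≠ a := by rintro rfl; omega
    have i1 := pval_inj w (a := y) (b := b) (by omega) (by omega) (by omega) (by omega)
    have i2 := pval_inj w (a := y') (b := b) (by omega) (by omega) (by omega) (by omega)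
    have i3 := pval_inj w (a := y) (b := y') (by omega) (by omega) (by omega) (by omega)
    rcases lt_or_ge (pval w y) (pval w y') with h1 | h1
    · exact hw.no52341 a y y' t b ha (by omega) (by omega) (by omega) (by omega) (by omega)
        (by omega) (by omega) (by omega) (by omega)
    · exact hw.no53241 a y y' t b ha (by omega) (by omega) (by omega) (by omega) (by omega)
        (by omega) (by omega) (by omega) (by omega)

end Corner

/-! ### Vanishing of minors -/

section Minors

variable {R : Type*} [CommRing R] {Z : ℕ → ℕ → R} {S T : Set ℕ} {s : ℕ}

/-- All minors of size `s` with rows in `S` and columns in `T` vanish. -/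
def MinorsVanish (Z : ℕ → ℕ → R) (S T : Set ℕ) (s : ℕ) : Prop :=
  ∀ a b : Fin s → ℕ, StrictMono a → StrictMono b → (∀ i, a i ∈ S) → (∀ i, b i ∈ T) →
    (Matrix.of fun i j => Z (a i) (b j)).det = 0

theorem MinorsVanish.mono {S' T' : Set ℕ} (h : MinorsVanish Z S T s) (hS : S' ⊆ S)
    (hT : T' ⊆ T) : MinorsVanish Z S' T' s :=
  fun a b ha hb ha' hb' => h a b ha hb (fun i => hS (ha' i)) fun i => hT (hb' i)

theorem MinorsVanish.flip (h : MinorsVanish Z S T s) :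
    MinorsVanish (fun i j => Z j i) T S s := fun a b ha hb ha' hb' => by
  rw [← h b a hb ha hb' ha', ← Matrix.det_transpose]
  rfl

theorem MinorsVanish.insert_row (h : MinorsVanish Z S T s) (x : ℕ) :
    MinorsVanish Z (insert x S) T (s + 1) := by
  intro a b ha hb ha' hb'
  obtain ⟨i₀, hi₀⟩ : ∃ i₀, ∀ k, k ≠ i₀ → a k ∈ S := by
    by_cases hx : ∃ i, a i = x
    · obtain ⟨i, hi⟩ := hx
      exact ⟨i, fun k hk => (ha' k).resolve_left fun e => hk (ha.injective (e.trans hi.symm))⟩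
    · push Not at hx
      exact ⟨0, fun k _ => (ha' k).resolve_left (hx k)⟩
  rw [Matrix.det_succ_row _ i₀]
  refine Finset.sum_eq_zero fun j _ => ?_
  have : ((Matrix.of fun i j => Z (a i) (b j)).submatrix i₀.succAbove j.succAbove).det = 0 :=
    h (a ∘ i₀.succAbove) (b ∘ j.succAbove) (ha.comp (Fin.strictMono_succAbove _))
      (hb.comp (Fin.strictMono_succAbove _)) (fun i => hi₀ _ (Fin.succAbove_ne _ _))
      fun i => hb' _
  rw [this, mul_zero]

theorem MinorsVanish.insert_column (h : MinorsVanish Z S T s) (x : ℕ) :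
    MinorsVanish Z S (insert x T) (s + 1) :=
  (h.flip.insert_row x).flip

theorem MinorsVanish.union_rows (h : MinorsVanish Z S T s) (F : Finset ℕ) :
    MinorsVanish Z (S ∪ F) T (s + F.card) := by
  induction F using Finset.induction_on with
  | empty => simpa using h
  | insert x F hx ih =>
    rw [Finset.card_insert_of_notMem hx, Finset.coe_insert, Set.union_insert, ← add_assoc]
    exact ih.insert_row x

theorem MinorsVanish.union_columns (h : MinorsVanish Z S T s) (F : Finset ℕ) :
    MinorsVanish Z S (T ∪ F) (s + F.card) :=
  (h.flip.union_rows F).flip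

theorem minorsVanish_one_iff :
    MinorsVanish Z S T 1 ↔ ∀ i ∈ S, ∀ j ∈ T, Z i j = 0 := by
  constructor
  · intro h i hi j hj
    simpa using h (fun _ => i) (fun _ => j) (Subsingleton.strictMono _)
      (Subsingleton.strictMono _) (fun _ => hi) fun _ => hj
  · intro h a b _ _ ha hb
    simpa using h _ (ha 0) _ (hb 0)

theorem minorsVanish_of_span {a₀ b₀ : Fin s → ℕ}
    (hrow : ∀ i ∈ S, (fun j : T => Z i j) ∈
      Submodule.span R (Set.range fun t (j : T) => Z (a₀ t) j))
    (hcol : ∀ j ∈ T, (fun t => Z (a₀ t) j) ∈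
      Submodule.span R (Set.range fun u t => Z (a₀ t) (b₀ u)))
    (hdet : (Matrix.of fun t u => Z (a₀ t) (b₀ u)).det = 0) : MinorsVanish Z S T s := by
  intro a b _ _ ha hb
  simp only [Submodule.mem_span_range_iff_exists_fun] at hrow hcol
  choose c hc using fun i => hrow (a i) (ha i)
  choose d hd using fun j => hcol (b j) (hb j)
  have : (Matrix.of fun i j => Z (a i) (b j)) = Matrix.of c *
      (Matrix.of fun t u => Z (a₀ t) (b₀ u)) * (Matrix.of d).transpose := by
    ext i j
    have h1 := congrFun (hc i) ⟨b j, hb j⟩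
    rw [Matrix.mul_assoc, Matrix.mul_apply]
    simp only [Finset.sum_apply, Pi.smul_apply, smul_eq_mul] at h1
    rw [Matrix.of_apply, ← h1]
    refine Finset.sum_congr rfl fun t _ => ?_
    have h2 := congrFun (hd j) t
    simp only [Finset.sum_apply, Pi.smul_apply, smul_eq_mul] at h2
    rw [← h2, Matrix.mul_apply]
    simp [mul_comm]
  rw [this, Matrix.det_mul, Matrix.det_mul, hdet, mul_zero, zero_mul]

theorem minorsVanish_succ_of_span {a₀ : Fin s → ℕ}
    (hrow : ∀ i ∈ S, (fun j : T => Z i j) ∈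
      Submodule.span R (Set.range fun t (j : T) => Z (a₀ t) j)) :
    MinorsVanish Z S T (s + 1) := by
  intro a b _ _ ha hb
  simp only [Submodule.mem_span_range_iff_exists_fun] at hrow
  choose c hc using fun i => hrow (a i) (ha i)
  have : (Matrix.of fun i j => Z (a i) (b j)) = Matrix.of (fun i => Fin.cons 0 (c i)) *
      (Matrix.of (Fin.cons 0 fun t j => Z (a₀ t) (b j)) : Matrix (Fin (s + 1)) (Fin (s + 1)) R) := by
    ext i j
    have h1 := congrFun (hc i) ⟨b j, hb j⟩
    simp only [Finset.sum_apply, Pi.smul_apply, smul_eq_mul] at h1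
    rw [Matrix.of_apply, ← h1, Matrix.mul_apply, Fin.sum_univ_succ]
    simp
  rw [this, Matrix.det_mul, Matrix.det_eq_zero_of_column_eq_zero 0 (by simp), zero_mul]

theorem mem_span_image_of_forall {M : Type*} [AddCommGroup M] [Module R M] (v : ℕ → M)
    (S F : Set ℕ) (μ : ℕ → ℕ)
    (h : ∀ i ∈ S, i ∈ F ∨ v i ∈ Submodule.span R (v '' {k | k ∈ S ∧ μ k < μ i})) :
    ∀ i ∈ S, v i ∈ Submodule.span R (v '' F) := by
  suffices ∀ N, ∀ i ∈ S, μ i = N → v i ∈ Submodule.span R (v '' F) from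
    fun i hi => this _ i hi rfl
  intro N
  induction N using Nat.strong_induction_on with
  | _ N ih =>
    intro i hi hN
    rcases h i hi with h1 | h1
    · exact Submodule.subset_span ⟨i, h1, rfl⟩
    · refine Submodule.span_le.2 ?_ h1
      rintro _ ⟨k, ⟨hk, hk'⟩, rfl⟩
      exact ih (μ k) (by omega) k hk rfl

end Minors

/-! ### Inverse pairs of unitriangular matrices -/

section InversePair

variable {R : Type*} [CommRing R]

/-- `Z` and `Y` are mutually inverse lower unitriangular matrices, indexed by `{1,…,n}`. -/
structure InversePair (n : ℕ) (Z Y : ℕ → ℕ → R) : Prop where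
  diag : ∀ i, 1 ≤ i → i ≤ n → Z i i = 1
  diag' : ∀ i, 1 ≤ i → i ≤ n → Y i i = 1
  upper : ∀ i j, i < j → Z i j = 0
  upper' : ∀ i j, i < j → Y i j = 0
  mul : ∀ i j, 1 ≤ j → j < i → i ≤ n → ∑ k ∈ Finset.Icc 1 n, Z i k * Y k j = 0
  mul' : ∀ i j, 1 ≤ j → j < i → i ≤ n → ∑ k ∈ Finset.Icc 1 n, Y i k * Z k j = 0

variable {n : ℕ} {Z Y : ℕ → ℕ → R}

theorem InversePair.row_relation (h : InversePair n Z Y) {p i j : ℕ} (hp : 1 ≤ p) (hpi : p ≤ i)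
    (hi : i ≤ n) (hj : 1 ≤ j) (hji : j < i) (hY : ∀ l, 1 ≤ l → l < p → Y i l = 0) :
    Z i j = ∑ k ∈ Finset.Ico p i, -Y i k * Z k j := by
  have h1 := h.mul' i j hj hji hi
  rw [← Finset.sum_subset (s₁ := Finset.Icc p i), ← Finset.Ico_insert_right hpi,
    Finset.sum_insert (by simp), h.diag' i (by omega) hi, one_mul] at h1
  · rw [eq_neg_of_add_eq_zero_left h1, ← Finset.sum_neg_distrib]
    simp only [neg_mul]
  · intro k hk
    simp only [Finset.mem_Icc] at hk ⊢
    omega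
  · intro k hk hk'
    simp only [Finset.mem_Icc] at hk hk'
    rcases lt_or_ge k p with h2 | h2
    · rw [hY k hk.1 h2, zero_mul]
    · rw [h.upper' i k (by omega), zero_mul]

theorem InversePair.column_relation (h : InversePair n Z Y) {q i j : ℕ} (hjq : j ≤ q)
    (hq : q ≤ n) (hi : i ≤ n) (hj : 1 ≤ j) (hji : j < i)
    (hY : ∀ k, q < k → k ≤ n → Y k j = 0) :
    Z i j = ∑ k ∈ Finset.Ioc j q, -Y k j * Z i k := by
  have h1 := h.mul i j hj hji hi
  rw [← Finset.sum_subset (s₁ := Finset.Icc j q), ← Finset.Ioc_insert_left hjq,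
    Finset.sum_insert (by simp), h.diag' j hj (by omega), mul_one] at h1
  · rw [eq_neg_of_add_eq_zero_left h1, ← Finset.sum_neg_distrib]
    exact Finset.sum_congr rfl fun k _ => by ring
  · intro k hk
    simp only [Finset.mem_Icc] at hk ⊢
    omega
  · intro k hk hk'
    simp only [Finset.mem_Icc] at hk hk'
    rcases lt_or_ge q k with h2 | h2
    · rw [hY k h2 hk.2, mul_zero]
    · rw [h.upper' k j (by omega), mul_zero]

/-- The adjugate of the matrix `Z`, with rows and columns indexed by `{1,…,n}`. -/
def adjugateEntry (n : ℕ) (Z : ℕ → ℕ → R) (i j : ℕ) : R :=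
  if h : (1 ≤ i ∧ i ≤ n) ∧ 1 ≤ j ∧ j ≤ n then
    (Matrix.of fun a b : Fin n => Z (a + 1) (b + 1)).adjugate ⟨i - 1, by omega⟩ ⟨j - 1, by omega⟩
  else 0

theorem map_adjugateEntry {R' : Type*} [CommRing R'] (φ : R →+* R') (i j : ℕ) :
    φ (adjugateEntry n Z i j) = adjugateEntry n (fun i j => φ (Z i j)) i j := by
  unfold adjugateEntry
  split_ifs
  · exact congrFun (congrFun (RingHom.map_adjugate φ
      (Matrix.of fun a b : Fin n => Z (a + 1) (b + 1))) _) _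
  · exact map_zero φ

theorem adjugateEntry_eq_zero {i j : ℕ}
    (h : MinorsVanish Z (Set.Icc 1 n \ {j}) (Set.Icc 1 n \ {i}) (n - 1)) :
    adjugateEntry n Z i j = 0 := by
  unfold adjugateEntry
  split_ifs with hij
  · obtain ⟨m, rfl⟩ : ∃ m, n = m + 1 := ⟨n - 1, by omega⟩
    have key : ∀ (x : Fin (m + 1)) (v : ℕ), v = x + 1 → ∀ k : Fin m, (x.succAbove k).val + 1 ∈
        Set.Icc 1 (m + 1) \ {v} := fun x v hv k => by
      have h1 := (x.succAbove k).isLt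
      have h2 := Fin.val_ne_of_ne (Fin.succAbove_ne x k)
      simp only [Set.mem_sdiff, Set.mem_Icc, Set.mem_singleton_iff]
      omega
    rw [Matrix.adjugate_fin_succ_eq_det_submatrix]
    have : ∀ x : Fin (m + 1), StrictMono fun k => (x.succAbove k).val + 1 := fun x a b hab =>
      Nat.add_lt_add_right (Fin.strictMono_succAbove x hab) 1
    have h' := h _ _ (this ⟨j - 1, by omega⟩) (this ⟨i - 1, by omega⟩)
      (key _ j (by simp only; omega)) (key _ i (by simp only; omega))
    exact mul_eq_zero_of_right _ h'
  · rfl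

theorem inversePair_adjugateEntry (hd : ∀ i, 1 ≤ i → i ≤ n → Z i i = 1)
    (hu : ∀ i j, i < j → Z i j = 0) : InversePair n Z (adjugateEntry n Z) := by
  set A : Matrix (Fin n) (Fin n) R := Matrix.of fun a b : Fin n => Z (a + 1) (b + 1) with hA
  have hdet : A.det = 1 := by
    rw [Matrix.det_of_isLowerTriangular A fun i j hij => hu _ _ (Nat.add_lt_add_right hij 1)]
    exact Finset.prod_eq_one fun i _ => hd _ (by omega) (by omega)
  have hsum : ∀ f : ℕ → R, ∑ k ∈ Finset.Icc 1 n, f k = ∑ a : Fin n, f (a + 1) := fun f => by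
    rw [Fin.sum_univ_eq_sum_range (fun a => f (a + 1)), Finset.range_eq_Ico,
      Finset.sum_Ico_add' f 0 n 1]
    rfl
  have hY : ∀ a b : Fin n, adjugateEntry n Z (a + 1) (b + 1) = A.adjugate a b := fun a b => by
    unfold adjugateEntry
    rw [dif_pos (by omega)]
    rfl
  have h1 : ∀ i j, 1 ≤ i → i ≤ n → 1 ≤ j → j ≤ n →
      ∑ k ∈ Finset.Icc 1 n, Z i k * adjugateEntry n Z k j = if i = j then 1 else 0 := by
    intro i j hi hin hj hjn
    obtain ⟨i, rfl⟩ : ∃ a : Fin n, i = a + 1 := ⟨⟨i - 1, by omega⟩, by simp only; omega⟩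
    obtain ⟨j, rfl⟩ : ∃ a : Fin n, j = a + 1 := ⟨⟨j - 1, by omega⟩, by simp only; omega⟩
    have := congrFun (congrFun (Matrix.mul_adjugate A) i) j
    rw [hdet, one_smul, Matrix.mul_apply, Matrix.one_apply] at this
    simp only [hsum, hY, add_left_inj, Fin.val_inj]
    exact this
  have h2 : ∀ i j, 1 ≤ i → i ≤ n → 1 ≤ j → j ≤ n →
      ∑ k ∈ Finset.Icc 1 n, adjugateEntry n Z i k * Z k j = if i = j then 1 else 0 := by
    intro i j hi hin hj hjn
    obtain ⟨i, rfl⟩ : ∃ a : Fin n, i = a + 1 := ⟨⟨i - 1, by omega⟩, by simp only; omega⟩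
    obtain ⟨j, rfl⟩ : ∃ a : Fin n, j = a + 1 := ⟨⟨j - 1, by omega⟩, by simp only; omega⟩
    have := congrFun (congrFun (Matrix.adjugate_mul A) i) j
    rw [hdet, one_smul, Matrix.mul_apply, Matrix.one_apply] at this
    simp only [hsum, hY, add_left_inj, Fin.val_inj]
    exact this
  have hup : ∀ i j, i < j → adjugateEntry n Z i j = 0 := by
    intro i
    induction i using Nat.strong_induction_on with
    | _ i ih =>
      intro j hij
      by_cases hr : (1 ≤ i ∧ i ≤ n) ∧ 1 ≤ j ∧ j ≤ n
      · have := h1 i j hr.1.1 hr.1.2 hr.2.1 hr.2.2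
        rw [if_neg hij.ne, Finset.sum_eq_single i, hd i hr.1.1 hr.1.2, one_mul] at this
        · exact this
        · intro k _ hk
          rcases lt_or_gt_of_ne hk with h3 | h3
          · rw [ih k h3 j (by omega), mul_zero]
          · rw [hu i k h3, zero_mul]
        · intro hc
          exact absurd (Finset.mem_Icc.2 hr.1) hc
      · unfold adjugateEntry
        rw [dif_neg hr]
  refine ⟨hd, fun i hi hin => ?_, hu, hup, fun i j hj hji hi => ?_, fun i j hj hji hi => ?_⟩
  · have := h1 i i hi hin hi hin
    rw [if_pos rfl, Finset.sum_eq_single i, hd i hi hin, one_mul] at this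
    · exact this
    · intro k _ hk
      rcases lt_or_gt_of_ne hk with h3 | h3
      · rw [hup k i h3, mul_zero]
      · rw [hu i k h3, zero_mul]
    · intro hc
      exact absurd (Finset.mem_Icc.2 ⟨hi, hin⟩) hc
  · rw [h1 i j (by omega) hi hj (by omega), if_neg hji.ne']
  · rw [h2 i j (by omega) hi hj (by omega), if_neg hji.ne']

end InversePair

/-! ### Rank conditions -/

section Rank

variable {n : ℕ} {w : Equiv.Perm (Fin n)} {R : Type*} [CommRing R] {Z Y : ℕ → ℕ → R}

theorem rk_succ_right {p q : ℕ} (hq : q + 1 ≤ n) :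
    rk w p (q + 1) = rk w p q + if p ≤ pval w (q + 1) then 1 else 0 := by
  unfold rk
  split_ifs with h
  · rw [← Finset.card_insert_of_notMem (a := q + 1) (by simp)]
    congr 1
    ext k
    simp only [Finset.mem_filter, Finset.mem_Icc, Finset.mem_insert]
    have : k = q + 1 → p ≤ pval w k := by rintro rfl; exact h
    omega
  · rw [add_zero]
    congr 1
    ext k
    simp only [Finset.mem_filter, Finset.mem_Icc]
    have : k = q + 1 → ¬ p ≤ pval w k := by rintro rfl; exact h
    omega

theorem rk_eq_succ_left {p q : ℕ} (hp : 1 ≤ p) (hpn : p ≤ n) :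
    rk w p q = rk w (p + 1) q + if pval w.symm p ≤ q then 1 else 0 := by
  obtain ⟨d, hd1, hdn, hdp, hd⟩ := exists_position w hp hpn
  rw [hd]
  have hne : ∀ k, 1 ≤ k ∧ k ≤ n → k ≠ d → pval w k ≠ p := fun k hk hkd e =>
    hkd (pval_inj w hk.1 hk.2 hd1 hdn (e.trans hdp.symm))
  unfold rk
  split_ifs with h
  · rw [← Finset.card_insert_of_notMem (a := d) (by simp [hdp])]
    congr 1
    ext k
    simp only [Finset.mem_filter, Finset.mem_Icc, Finset.mem_insert]
    have h1 : k = d → pval w k = p := by rintro rfl; exact hdp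
    have h2 := hne k
    omega
  · rw [add_zero]
    congr 1
    ext k
    simp only [Finset.mem_filter, Finset.mem_Icc]
    have h1 : k = d → pval w k = p := by rintro rfl; exact hdp
    have h2 := hne k
    omega

theorem minorsVanish_of_mem_diagram
    (h : ∀ p q, (p, q) ∈ EssSet w → MinorsVanish Z (Set.Icc p n) (Set.Icc 1 q) (rk w p q + 1))
    {p q : ℕ} (hpq : (p, q) ∈ Diagram w) :
    MinorsVanish Z (Set.Icc p n) (Set.Icc 1 q) (rk w p q + 1) := by
  induction hN : p + (n - q) using Nat.strong_induction_on generalizing p q with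
  | _ N ih =>
    obtain ⟨hp, hpn, hq, hqn, hwq, hqp⟩ := id hpq
    simp only at hp hpn hq hqn hwq hqp
    by_cases h1 : (p, q + 1) ∈ Diagram w
    · obtain ⟨-, -, -, hqn', hwq', -⟩ := id h1
      simp only at hqn' hwq'
      have := ih _ (by omega) h1 rfl
      rw [rk_succ_right hqn', if_neg (by omega), add_zero] at this
      exact this.mono subset_rfl (Set.Icc_subset_Icc_right (by omega))
    · by_cases h2 : (p - 1, q) ∈ Diagram w
      · obtain ⟨hp', -, -, -, -, hqp'⟩ := id h2
        simp only at hp' hqp'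
        have := ih _ (by omega) h2 rfl
        rw [rk_eq_succ_left hp' (by omega), if_neg (by omega), add_zero,
          Nat.sub_add_cancel hp] at this
        exact this.mono (Set.Icc_subset_Icc_left (by omega)) subset_rfl
      · exact h p q ⟨hpq, h1, h2⟩

/-- The rank conditions at the essential boxes imply all rank conditions. -/
theorem minorsVanish_rk
    (h : ∀ p q, (p, q) ∈ EssSet w → MinorsVanish Z (Set.Icc p n) (Set.Icc 1 q) (rk w p q + 1))
    {p q : ℕ} (hp : 1 ≤ p) (hq : q ≤ n) :
    MinorsVanish Z (Set.Icc p n) (Set.Icc 1 q) (rk w p q + 1) := by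
  induction hN : n + 1 - p + q using Nat.strong_induction_on generalizing p q with
  | _ N ih =>
    by_cases hpn : p ≤ n
    · by_cases hq0 : 1 ≤ q
      · by_cases hwq : p ≤ pval w q
        · obtain ⟨k, rfl⟩ : ∃ k, q = k + 1 := ⟨q - 1, by omega⟩
          have := (ih _ (by omega) hp (q := k) (by omega) rfl).insert_column (k + 1)
          rw [rk_succ_right hq, if_pos hwq]
          refine this.mono subset_rfl fun x hx => ?_
          simp only [Set.mem_Icc, Set.mem_insert_iff] at hx ⊢
          omega
        · by_cases hqp : pval w.symm p ≤ q
          · have := (ih _ (by omega) (p := p + 1) (by omega) hq rfl).insert_row p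
            rw [rk_eq_succ_left hp hpn, if_pos hqp]
            refine this.mono (fun x hx => ?_) subset_rfl
            simp only [Set.mem_Icc, Set.mem_insert_iff] at hx ⊢
            omega
          · exact minorsVanish_of_mem_diagram h
              ⟨hp, hpn, hq0, hq, not_le.1 hwq, not_le.1 hqp⟩
      · intro a b _ _ _ hb
        have := hb 0
        simp only [Set.mem_Icc] at this
        omega
    · intro a b _ _ ha _
      have := ha 0
      simp only [Set.mem_Icc] at this
      omega

theorem entry_eq_zero_of_minorsVanish
    (h : ∀ p q, (p, q) ∈ EssSet w → MinorsVanish Z (Set.Icc p n) (Set.Icc 1 q) (rk w p q + 1))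
    {i j : ℕ} (hi : i ≤ n) (hj : 1 ≤ j) (hjn : j ≤ n) (hij : prefixMax w j < i) : Z i j = 0 := by
  have h1 := minorsVanish_rk h (p := i) (by omega) hjn
  have : rk w i j = 0 := by
    unfold rk
    rw [Finset.card_eq_zero, Finset.filter_eq_empty_iff]
    intro k hk hk'
    have := pval_le_prefixMax (w := w) (Finset.mem_Icc.1 hk).1 hk'.1
    omega
  rw [this, zero_add, minorsVanish_one_iff] at h1
  exact h1 i ⟨le_rfl, hi⟩ j ⟨hj, le_rfl⟩

theorem rk_add_of_positions_le {p q : ℕ} (hp : p ≤ n + 1) (hp1 : 1 ≤ p) (hqn : q ≤ n)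
    (h : prefixMax w.symm (p - 1) ≤ q) : rk w p q + (p - 1) = q := by
  have h1 := card_low_add_rk (w := w) (p := p) hqn
  have h2 := card_filter_pval w (fun v => v < p)
  rw [card_filter_lt hp] at h2
  rw [← h2, add_comm]
  conv_rhs => rw [← h1]
  congr 2
  ext k
  simp only [Finset.mem_filter, Finset.mem_Icc]
  have := position_le (w := w) (k := k) (j := p - 1)
  omega

theorem adjugateEntry_eq_zero_of_minorsVanish
    (h : ∀ p q, (p, q) ∈ EssSet w → MinorsVanish Z (Set.Icc p n) (Set.Icc 1 q) (rk w p q + 1))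
    {i j : ℕ} (hi : i ≤ n) (hj : 1 ≤ j) (hjn : j ≤ n) (hij : prefixMax w.symm j < i) :
    adjugateEntry n Z i j = 0 := by
  have hji := le_prefixMax (w := w.symm) hjn
  have h1 := ((minorsVanish_rk h (p := j + 1) (q := i - 1) (by omega) (by omega)).union_rows
    (Finset.Ico 1 j)).union_columns (Finset.Ioc i n)
  have h2 := rk_add_of_positions_le (w := w) (p := j + 1) (q := i - 1) (by omega) (by omega)
    (by omega) (by rw [Nat.add_sub_cancel]; omega)
  rw [Nat.card_Ico, Nat.card_Ioc, show rk w (j + 1) (i - 1) + 1 + (j - 1) + (n - i) = n - 1 by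
    omega] at h1
  refine adjugateEntry_eq_zero (h1.mono ?_ ?_) <;>
  · intro x hx
    simp only [Set.mem_sdiff, Set.mem_Icc, Set.mem_singleton_iff, Finset.coe_Ico, Finset.coe_Ioc,
      Set.mem_union, Set.mem_Ico, Set.mem_Ioc] at hx ⊢
    omega

end Rank

/-! ### The chosen equations imply all rank conditions -/

section Equations

variable {n : ℕ} {w : Equiv.Perm (Fin n)} {R : Type*} [CommRing R] {Z Y : ℕ → ℕ → R}

theorem mem_inverseEqs {i j : ℕ} :
    (i, j) ∈ inverseEqs w ↔ (1 ≤ i ∧ i ≤ n) ∧ (1 ≤ j ∧ j ≤ n) ∧ prefixMax w.symm j < i := by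
  simp only [inverseEqs, Finset.mem_filter, Finset.mem_product, Finset.mem_Icc, and_assoc]

theorem mem_entryEqs {i j : ℕ} :
    (i, j) ∈ entryEqs w ↔ (1 ≤ i ∧ i ≤ n) ∧ (1 ≤ j ∧ j ≤ n) ∧ prefixMax w j < i ∧
      i ≤ prefixMax w (prefixMax w.symm j) ∧ i ≤ prefixMax w.symm (prefixMax w j) := by
  simp only [entryEqs, Finset.mem_filter, Finset.mem_product, Finset.mem_Icc, and_assoc]

/-- The entries of the inverse matrix given by `inverseEqs` and the entries given by `entryEqs`
vanish. -/
structure SatisfiesEntries (w : Equiv.Perm (Fin n)) (Z Y : ℕ → ℕ → R) : Prop where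
  inverse : ∀ i j, (i, j) ∈ inverseEqs w → Y i j = 0
  entry : ∀ i j, (i, j) ∈ entryEqs w → Z i j = 0

theorem SatisfiesEntries.inverse_eq_zero (h : SatisfiesEntries w Z Y) {i j : ℕ} (hi : i ≤ n)
    (hj : 1 ≤ j) (hjn : j ≤ n) (hij : prefixMax w.symm j < i) : Y i j = 0 :=
  h.inverse i j (mem_inverseEqs.2 (by omega))

theorem SatisfiesEntries.entry_eq_zero (hI : InversePair n Z Y) (h : SatisfiesEntries w Z Y)
    {i j : ℕ} (hi : i ≤ n) (hj : 1 ≤ j) (hjn : j ≤ n) (hij : prefixMax w j < i) : Z i j = 0 := by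
  induction hN : i + (n - j) using Nat.strong_induction_on generalizing i j with
  | _ N ih =>
    have hjm := le_prefixMax (w := w) hjn
    have hjg := le_prefixMax (w := w.symm) hjn
    rcases lt_or_ge (prefixMax w.symm (prefixMax w j)) i with h1 | h1
    · rw [hI.row_relation (p := prefixMax w j + 1) (by omega) (by omega) hi hj (by omega)]
      · refine Finset.sum_eq_zero fun k hk => ?_
        rw [Finset.mem_Ico] at hk
        rw [ih _ (by omega) (i := k) (by omega) hj hjn (by omega) rfl, mul_zero]
      · intro l hl hl'
        have := prefixMax_mono (w := w.symm) (i := l) (j := prefixMax w j) (by omega)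
        exact h.inverse_eq_zero hi hl (by omega) (by omega)
    rcases lt_or_ge (prefixMax w (prefixMax w.symm j)) i with h2 | h2
    · have hgn := prefixMax_le_card (w := w.symm) j
      rw [hI.column_relation hjg hgn hi hj (by omega)]
      · refine Finset.sum_eq_zero fun k hk => ?_
        rw [Finset.mem_Ioc] at hk
        have := prefixMax_mono (w := w) hk.2
        rw [ih _ (by omega) (j := k) hi (by omega) (by omega) (by omega) rfl, mul_zero]
      · intro k hk hk'
        exact h.inverse_eq_zero hk' hj hjn hk
    · exact h.entry i j (mem_entryEqs.2 (by omega))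

theorem range_add_eq_Ico (p s : ℕ) : Set.range (fun t : Fin s => p + t.val) = Set.Ico p (p + s) := by
  ext k
  simp only [Set.mem_range, Set.mem_Ico]
  exact ⟨fun ⟨t, ht⟩ => by omega, fun hk => ⟨⟨k - p, by omega⟩, by simp only; omega⟩⟩

/-- Below the row `g(p-1)`, the rows of `Z` are combinations of the rows above them, starting
with row `p`. -/
theorem SatisfiesEntries.row_mem_span (hI : InversePair n Z Y) (h : SatisfiesEntries w Z Y)
    {p q i : ℕ} (hp : 1 ≤ p) (hpi : p ≤ i) (hi : i ≤ n) (hqi : q < i)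
    (hpg : prefixMax w.symm (p - 1) < i) :
    (fun j : Set.Icc 1 q => Z i j) ∈ Submodule.span R
      ((fun i (j : Set.Icc 1 q) => Z i j) '' {k | k ∈ Set.Icc p n ∧ k < i}) := by
  have : (fun j : Set.Icc 1 q => Z i j) =
      ∑ k ∈ Finset.Ico p i, (-Y i k) • fun j : Set.Icc 1 q => Z k j := by
    ext ⟨j, hj⟩
    rw [Set.mem_Icc] at hj
    simp only [Finset.sum_apply, Pi.smul_apply, smul_eq_mul]
    refine hI.row_relation hp hpi hi hj.1 (by omega) fun l hl hl' => ?_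
    have := prefixMax_mono (w := w.symm) (i := l) (j := p - 1) (by omega)
    exact h.inverse_eq_zero hi hl (by omega) (by omega)
  rw [this]
  refine Submodule.sum_mem _ fun k hk => Submodule.smul_mem _ _ (Submodule.subset_span ⟨k, ?_, rfl⟩)
  rw [Finset.mem_Ico] at hk
  exact ⟨⟨hk.1, by omega⟩, hk.2⟩

theorem SatisfiesEntries.minorsVanish_of_condB (hI : InversePair n Z Y)
    (h : SatisfiesEntries w Z Y) {p q : ℕ} (hp : 1 ≤ p) (hpn : p ≤ n) (hq : q ≤ n)
    (hB : CondB w p q) : MinorsVanish Z (Set.Icc p n) (Set.Icc 1 q) (rk w p q + 1) := by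
  have hg : prefixMax w.symm (p - 1) ≤ q := by
    by_contra hc
    obtain ⟨h1, h2, h3⟩ := exists_last_position (w := w) (j := p - 1)
      (by
        by_contra h0
        rw [show p - 1 = 0 by omega] at hc
        exact hc (prefixMax_le fun k _ _ => by omega)) (by omega)
    exact hB ⟨_, h1, prefixMax_le_card _, not_le.1 hc, by omega⟩
  have hr := rk_add_of_positions_le (w := w) (p := p) (by omega) hp hq hg
  refine minorsVanish_succ_of_span (a₀ := fun t => p + t.val) fun i hi => ?_
  have := mem_span_image_of_forall (R := R) (fun i (j : Set.Icc 1 q) => Z i j) (Set.Icc p n)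
    (Set.Ico p (p + rk w p q)) id (fun i hi => ?_) i hi
  · rwa [← range_add_eq_Ico, ← Set.range_comp] at this
  · rw [Set.mem_Icc] at hi
    rcases lt_or_ge q i with h1 | h1
    · exact Or.inr (h.row_mem_span (i := i) hI hp hi.1 hi.2 h1 (by omega))
    · exact Or.inl (Set.mem_Ico.2 (by omega))

theorem IsDeterminantal.rank_bounds {p q : ℕ} (h : IsDeterminantal w p q) :
    p + rk w p q ≤ n ∧ rk w p q + 1 ≤ q ∧ q < p + rk w p q := by
  obtain ⟨hp, hpn, hq, hqn, hwq, hwq', -, -⟩ := h.facts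
  have hB := h.2.2
  simp only [CondB, not_not] at hB
  obtain ⟨b, hb1, hbn, hqb, hbp⟩ := hB
  have h1 := card_high_add_rk (w := w) p q (by omega)
  have h2 := card_low_add_rk (w := w) (p := p) (q := q) (by omega)
  have h3 : 0 < ((Finset.Icc 1 n).filter fun k => q < k ∧ p ≤ pval w k).card :=
    Finset.card_pos.2 ⟨q + 1, by simp only [Finset.mem_filter, Finset.mem_Icc]; omega⟩
  have h4 : 0 < ((Finset.Icc 1 n).filter fun k => k ≤ q ∧ pval w k < p).card :=
    Finset.card_pos.2 ⟨q, by simp only [Finset.mem_filter, Finset.mem_Icc]; omega⟩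
  have h5 : ((Finset.Icc 1 n).filter fun k => k ≤ q ∧ pval w k < p).card <
      ((Finset.Icc 1 n).filter fun k => pval w k < p).card := by
    refine Finset.card_lt_card (Finset.ssubset_iff_of_subset ?_ |>.2 ⟨b, ?_, ?_⟩)
    · intro k hk
      simp only [Finset.mem_filter] at hk ⊢
      exact ⟨hk.1, hk.2.2⟩
    · simp only [Finset.mem_filter, Finset.mem_Icc]
      omega
    · simp only [Finset.mem_filter]
      omega
  have h6 := card_filter_pval w (fun v => v < p)
  rw [card_filter_lt (by omega)] at h6
  omega

theorem SatisfiesEntries.minorsVanish_of_isDeterminantal (hw : AvoidsSix w)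
    (hI : InversePair n Z Y) (h : SatisfiesEntries w Z Y) {p q : ℕ} (hpq : IsDeterminantal w p q)
    (hdet : (Matrix.of fun t u : Fin (rk w p q + 1) => Z (p + t) (q - rk w p q + u)).det = 0) :
    MinorsVanish Z (Set.Icc p n) (Set.Icc 1 q) (rk w p q + 1) := by
  obtain ⟨hp, hpn, hq, hqn, -⟩ := hpq.facts
  obtain ⟨hr1, hr2, hr3⟩ := hpq.rank_bounds
  have hrows := hpq.rows hw
  have hcolumns := hpq.columns hw
  set r := rk w p q with hr
  refine minorsVanish_of_span (a₀ := fun t => p + t.val) (b₀ := fun u => q - r + u.val)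
    (fun i hi => ?_) (fun j hj => ?_) hdet
  · have := mem_span_image_of_forall (R := R) (fun i (j : Set.Icc 1 q) => Z i j) (Set.Icc p n)
      (Set.Ico p (p + (r + 1))) id (fun i hi => ?_) i hi
    · rwa [← range_add_eq_Ico, ← Set.range_comp] at this
    · rw [Set.mem_Icc] at hi
      rcases lt_or_ge (p + r) i with h1 | h1
      · refine Or.inr ?_
        rcases hrows with h2 | h2
        · have : (fun j : Set.Icc 1 q => Z i j) = 0 := by
            ext ⟨j, hj⟩
            rw [Set.mem_Icc] at hj
            have := prefixMax_mono (w := w) hj.2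
            exact h.entry_eq_zero (j := j) hI hi.2 hj.1 (by omega) (by omega)
          rw [this]
          exact Submodule.zero_mem _
        · exact h.row_mem_span (i := i) hI (by omega) hi.1 hi.2 (by omega) (by omega)
      · exact Or.inl (Set.mem_Ico.2 (by omega))
  · have := mem_span_image_of_forall (R := R) (fun j (t : Fin (r + 1)) => Z (p + t) j)
      (Set.Icc 1 q) (Set.Ico (q - r) (q - r + (r + 1))) (fun j => q - j) (fun j hj => ?_) j hj
    · rwa [← range_add_eq_Ico, ← Set.range_comp] at this
    · rw [Set.mem_Icc] at hj
      rcases lt_or_ge j (q - r) with h1 | h1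
      · refine Or.inr ?_
        rcases hcolumns with h2 | h2
        · have : (fun t : Fin (r + 1) => Z (p + t) j) = 0 := by
            ext t
            have := prefixMax_mono (w := w) (i := j) (j := q - r - 1) (by omega)
            exact h.entry_eq_zero hI (by omega) hj.1 (by omega) (by omega)
          rw [this]
          exact Submodule.zero_mem _
        · have : (fun t : Fin (r + 1) => Z (p + t) j) =
              ∑ k ∈ Finset.Ioc j q, (-Y k j) • fun t : Fin (r + 1) => Z (p + t) k := by
            ext t
            simp only [Finset.sum_apply, Pi.smul_apply, smul_eq_mul]
            refine hI.column_relation hj.2 (by omega) (by omega) hj.1 (by omega) fun k hk hk' => ?_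
            have := prefixMax_mono (w := w.symm) (i := j) (j := q - r - 1) (by omega)
            exact h.inverse_eq_zero hk' hj.1 (by omega) (by omega)
          rw [this]
          refine Submodule.sum_mem _ fun k hk =>
            Submodule.smul_mem _ _ (Submodule.subset_span ⟨k, ?_, rfl⟩)
          rw [Finset.mem_Ioc] at hk
          exact ⟨⟨by omega, hk.2⟩, by omega⟩
      · exact Or.inl (Set.mem_Ico.2 (by omega))

theorem minorsVanish_iff_equations (hw : AvoidsSix w) (hd : ∀ i, 1 ≤ i → i ≤ n → Z i i = 1)
    (hu : ∀ i j, i < j → Z i j = 0) :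
    (∀ p q, (p, q) ∈ EssSet w →
      MinorsVanish Z (Set.Icc p n) (Set.Icc 1 q) (rk w p q + 1)) ↔
    SatisfiesEntries w Z (adjugateEntry n Z) ∧ ∀ p q, (p, q) ∈ determinantalBoxes w →
      (Matrix.of fun t u : Fin (rk w p q + 1) => Z (p + t) (q - rk w p q + u)).det = 0 := by
  constructor
  · refine fun h => ⟨⟨fun i j hij => ?_, fun i j hij => ?_⟩, fun p q hpq => ?_⟩
    · obtain ⟨⟨-, h1⟩, ⟨h2, h3⟩, h4⟩ := mem_inverseEqs.1 hij
      exact adjugateEntry_eq_zero_of_minorsVanish h h1 h2 h3 h4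
    · obtain ⟨⟨-, h1⟩, ⟨h2, h3⟩, h4, -⟩ := mem_entryEqs.1 hij
      exact entry_eq_zero_of_minorsVanish h h1 h2 h3 h4
    · have hpq' := mem_determinantalBoxes.1 hpq
      obtain ⟨h1, h2, -⟩ := hpq'.rank_bounds
      exact h p q hpq'.1 _ _ (fun a b hab => Nat.add_lt_add_left hab _)
        (fun a b hab => Nat.add_lt_add_left hab _)
        (fun i => Set.mem_Icc.2 (by omega)) (fun i => Set.mem_Icc.2 (by omega))
  · rintro ⟨h, hdet⟩ p q hpq
    have hI := inversePair_adjugateEntry hd hu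
    obtain ⟨hp, hpn, hq, hqn, -, -⟩ := hpq.1
    simp only at hp hpn hq hqn
    by_cases hA : CondA w p q
    · have : rk w p q = 0 := by
        unfold rk
        rw [Finset.card_eq_zero, Finset.filter_eq_empty_iff]
        intro k hk hk'
        rw [Finset.mem_Icc] at hk
        exact hA ⟨k, hk.1, hk.2, hk'⟩
      rw [this, zero_add, minorsVanish_one_iff]
      intro i hi j hj
      rw [Set.mem_Icc] at hi hj
      have hm : prefixMax w q < p := by
        obtain ⟨k, h1, h2, h3⟩ := exists_prefixMax (w := w) hq
        by_contra hc
        exact hA ⟨k, h1, by omega, h2, by omega⟩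
      have := prefixMax_mono (w := w) hj.2
      exact h.entry_eq_zero hI hi.2 hj.1 (by omega) (by omega)
    by_cases hB : CondB w p q
    · exact h.minorsVanish_of_condB hI hp hpn hqn hB
    · exact h.minorsVanish_of_isDeterminantal hw hI ⟨hpq, hA, hB⟩
        (hdet p q (mem_determinantalBoxes.2 ⟨hpq, hA, hB⟩))

end Equations

/-! ### The ideal -/

section Ideal

variable {n : ℕ} {w : Equiv.Perm (Fin n)} {R : Type*} [CommRing R]

theorem dminor_eq_det {A B : Finset ℕ} {s : ℕ} (hA : A.card = s) (hB : B.card = s) :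
    dminor n A B = (Matrix.of fun i j : Fin s =>
      Mmat n (A.orderEmbOfFin hA i) (B.orderEmbOfFin hB j)).det := by
  subst hA
  unfold dminor
  rw [dif_pos hB]
  rfl

theorem Iideal_le_ker_iff (φ : PolyS n →+* R) (p q r : ℕ) :
    Iideal n p q r ≤ RingHom.ker φ ↔
      MinorsVanish (fun i j => φ (Mmat n i j)) (Set.Icc p n) (Set.Icc 1 q) (r + 1) := by
  have hmap : ∀ {s : ℕ} (a b : Fin s → ℕ), φ (Matrix.of fun i j => Mmat n (a i) (b j)).det =
      (Matrix.of fun i j => φ (Mmat n (a i) (b j))).det := fun a b => by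
    rw [RingHom.map_det]
    rfl
  unfold Iideal
  rw [Ideal.span_le]
  constructor
  · intro h a b ha hb ha' hb'
    have hA : (Finset.univ.image a).card = r + 1 := by
      rw [Finset.card_image_of_injective _ ha.injective, Finset.card_fin]
    have hB : (Finset.univ.image b).card = r + 1 := by
      rw [Finset.card_image_of_injective _ hb.injective, Finset.card_fin]
    have h1 := h ⟨_, _, hA, hB, ?_, ?_, rfl⟩
    · rw [SetLike.mem_coe, RingHom.mem_ker, dminor_eq_det hA hB, hmap,
        ← Finset.orderEmbOfFin_unique hA (fun x => Finset.mem_image_of_mem _ (Finset.mem_univ x)) ha,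
        ← Finset.orderEmbOfFin_unique hB (fun x => Finset.mem_image_of_mem _ (Finset.mem_univ x)) hb]
        at h1
      exact h1
    · exact Finset.image_subset_iff.2 fun i _ => Finset.mem_Icc.2 (ha' i)
    · exact Finset.image_subset_iff.2 fun i _ => Finset.mem_Icc.2 (hb' i)
  · rintro h _ ⟨A, B, hA, hB, hA', hB', rfl⟩
    rw [SetLike.mem_coe, RingHom.mem_ker, dminor_eq_det hA hB, hmap]
    exact h _ _ (OrderEmbedding.strictMono _) (OrderEmbedding.strictMono _)
      (fun i => Finset.mem_Icc.1 (hA' (Finset.orderEmbOfFin_mem _ _ _)))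
      fun i => Finset.mem_Icc.1 (hB' (Finset.orderEmbOfFin_mem _ _ _))

theorem Iw_le_ker_iff (φ : PolyS n →+* R) : Iw w ≤ RingHom.ker φ ↔ ∀ p q, (p, q) ∈ EssSet w →
    MinorsVanish (fun i j => φ (Mmat n i j)) (Set.Icc p n) (Set.Icc 1 q) (rk w p q + 1) := by
  simp only [Iw, iSup_le_iff, Prod.forall, Iideal_le_ker_iff]

variable (w) in
/-- The chosen generators of `I_w`. -/
noncomputable def generators : Finset (PolyS n) :=
  open Classical in
  ((inverseEqs w).image fun x => adjugateEntry n (Mmat n) x.1 x.2) ∪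
    ((entryEqs w).image fun x => Mmat n x.1 x.2) ∪
    ((determinantalBoxes w).image fun x => (Matrix.of fun t u : Fin (rk w x.1 x.2 + 1) =>
      Mmat n (x.1 + t) (x.2 - rk w x.1 x.2 + u)).det)

theorem card_generators_le (hw : AvoidsSix w) :
    (generators w).card ≤ n * (n - 1) / 2 - ell w := by
  classical
  rw [← card_noninversions]
  refine le_trans ?_ (card_equations_le hw)
  unfold generators
  refine (Finset.card_union_le _ _).trans (Nat.add_le_add ((Finset.card_union_le _ _).trans
    (Nat.add_le_add ?_ ?_)) ?_) <;>
  exact Finset.card_image_le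

theorem forall_mem_generators (P : PolyS n → Prop) : (∀ f ∈ generators w, P f) ↔
    ((∀ i j, (i, j) ∈ inverseEqs w → P (adjugateEntry n (Mmat n) i j)) ∧
      ∀ i j, (i, j) ∈ entryEqs w → P (Mmat n i j)) ∧
    ∀ p q, (p, q) ∈ determinantalBoxes w → P (Matrix.of fun t u : Fin (rk w p q + 1) =>
      Mmat n (p + t) (q - rk w p q + u)).det := by
  classical
  simp only [generators, Finset.mem_union, or_imp, forall_and, Finset.forall_mem_image,
    Prod.forall]

theorem Iw_le_ker_iff_span_le_ker (hw : AvoidsSix w) (φ : PolyS n →+* R) :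
    Iw w ≤ RingHom.ker φ ↔ Ideal.span (generators w : Set (PolyS n)) ≤ RingHom.ker φ := by
  rw [Iw_le_ker_iff, minorsVanish_iff_equations hw, Ideal.span_le]
  · refine Iff.trans ?_ (forall_mem_generators (w := w) fun f => φ f = 0).symm
    simp only [map_adjugateEntry, RingHom.map_det]
    exact and_congr_left fun _ => ⟨fun h => ⟨h.inverse, h.entry⟩, fun h => ⟨h.1, h.2⟩⟩
  · intro i h1 h2
    rw [Mmat, if_pos ⟨rfl, h1, h2⟩, map_one]
  · intro i j hij
    rw [Mmat, if_neg (by omega), zvar, dif_neg (by omega), map_zero]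

theorem span_generators (hw : AvoidsSix w) :
    Ideal.span (generators w : Set (PolyS n)) = Iw w := by
  apply le_antisymm
  · have := (Iw_le_ker_iff_span_le_ker hw (Ideal.Quotient.mk (Iw w))).1
    rw [Ideal.mk_ker] at this
    exact this le_rfl
  · have := (Iw_le_ker_iff_span_le_ker hw
      (Ideal.Quotient.mk (Ideal.span (generators w : Set (PolyS n))))).2
    rw [Ideal.mk_ker] at this
    exact this le_rfl

theorem exists_span_range_eq_of_card_le {A : Type*} [CommRing A] (G : Finset A) {N : ℕ}
    (h : G.card ≤ N) : ∃ g : Fin N → A, Ideal.span (Set.range g) = Ideal.span G := by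
  refine ⟨fun i => if hi : i.val < G.card then (G.equivFin.symm ⟨i, hi⟩ : A) else 0,
    le_antisymm (Ideal.span_le.2 ?_) (Ideal.span_le.2 fun x hx => ?_)⟩
  · rintro _ ⟨i, rfl⟩
    simp only
    split_ifs with hi
    · exact Ideal.subset_span (Subtype.prop _)
    · exact Ideal.zero_mem _
  · refine Ideal.subset_span ⟨⟨G.equivFin ⟨x, hx⟩, by omega⟩, ?_⟩
    simp

end Ideal

/-- If `w` avoids 53241, 52341, 52431, 35142, 42513 and 351624, then the ideal `I_w`
can be generated by `n(n−1)/2 − ℓ(w)` elements. -/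
theorem Iw_generated_of_avoids {n : ℕ} (w : Equiv.Perm (Fin n))
    (h1 : ¬ Contains w [5, 3, 2, 4, 1]) (h2 : ¬ Contains w [5, 2, 3, 4, 1])
    (h3 : ¬ Contains w [5, 2, 4, 3, 1]) (h4 : ¬ Contains w [3, 5, 1, 4, 2])
    (h5 : ¬ Contains w [4, 2, 5, 1, 3]) (h6 : ¬ Contains w [3, 5, 1, 6, 2, 4]) :
    ∃ g : Fin (n * (n - 1) / 2 - ell w) → PolyS n,
      Ideal.span (Set.range g) = Iw w := by
  have hw := AvoidsSix.of_not_contains h1 h2 h3 h4 h5 h6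
  obtain ⟨g, hg⟩ := exists_span_range_eq_of_card_le _ (card_generators_le hw)
  exact ⟨g, hg.trans (span_generators hw)⟩
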